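/- arXiv:1812.02298 — 4 statements merged into one kernel-verified Lean document; each statement's English description precedes it below -/
import Mathlib

section
/- Diffusion limit for the general compound Hawkes process with n-state dependent orders (covers Theorems 'Diffusion Limit for NLCHPnSDO' and 'Diffusion limit for GCHPnSDO'): For every t > 0, the random variables (S_{nt} − N_{nt}·a*)/√n converge in distribution, as n → ∞, to a centered Gaussian random variable with variance (σ*)²·c·t; equivalently, to σ*·√c · W_t where W is a standard Brownian motion. -/
open MeasureTheory ProbabilityTheory Filter Finset Matrix Topology

/-- Maximum principle: a harmonic vector of a row-stochastic matrix with positive entries is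
constant. -/
theorem eq_of_pos_stochastic_harmonic {ι : Type*} [Fintype ι] [Nonempty ι] {Q : Matrix ι ι ℝ}
    (hpos : ∀ i j, 0 < Q i j) (hrow : ∀ i, ∑ j, Q i j = 1) {x : ι → ℝ} (hx : Q *ᵥ x = x)
    (i j : ι) : x i = x j := by
  obtain ⟨l, hl⟩ := Finite.exists_max x
  have key : ∀ j, x j = x l := by
    have h0 : ∑ j, Q l j * (x l - x j) = 0 := by
      have h1 : ∑ j, Q l j * x j = x l := congrFun hx l
      simp only [mul_sub, Finset.sum_sub_distrib, ← Finset.sum_mul, hrow, h1]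
      ring
    have h2 := (Finset.sum_eq_zero_iff_of_nonneg
      (fun j _ => mul_nonneg (hpos l j).le (sub_nonneg.2 (hl j)))).1 h0
    intro j
    have h3 := (mul_eq_zero.1 (h2 j (Finset.mem_univ j))).resolve_left (hpos l j).ne'
    linarith
  rw [key i, key j]

/-- A stationary distribution preserves the mean of every function. -/
theorem sum_stationary_mul_mulVec {ι : Type*} [Fintype ι] {P : Matrix ι ι ℝ} {p : ι → ℝ}
    (hstat : ∀ j, ∑ i, p i * P i j = p j) (x : ι → ℝ) :
    ∑ i, p i * ∑ j, P i j * x j = ∑ j, p j * x j := by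
  simp_rw [Finset.mul_sum]
  rw [Finset.sum_comm]
  refine Finset.sum_congr rfl fun j _ => ?_
  simp_rw [← mul_assoc]
  rw [← Finset.sum_mul, hstat j]

/-- The matrix `P + Π - 1` of a primitive stochastic matrix `P`, where each row of `Π` is the
stationary distribution, is invertible. -/
theorem isUnit_det_add_stationary_sub_one {ι : Type*} [Fintype ι] [DecidableEq ι] [Nonempty ι]
    {P : Matrix ι ι ℝ} (hrow : ∀ i, ∑ j, P i j = 1) (hprim : ∃ k : ℕ, ∀ i j, 0 < (P ^ k) i j)
    {p : ι → ℝ} (hsum : ∑ i, p i = 1) (hstat : ∀ j, ∑ i, p i * P i j = p j) :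
    IsUnit (P + Matrix.of (fun _ j => p j) - 1).det := by
  rw [isUnit_iff_ne_zero]
  intro hdet
  obtain ⟨x, hx0, hx⟩ := Matrix.exists_mulVec_eq_zero_iff.2 hdet
  have hcoord : ∀ i, ∑ j, P i j * x j + ∑ j, p j * x j - x i = 0 := by
    intro i
    have := congrFun hx i
    rw [Matrix.sub_mulVec, Matrix.add_mulVec, Matrix.one_mulVec] at this
    simpa [Matrix.mulVec, dotProduct] using this
  have hpP := sum_stationary_mul_mulVec hstat x
  have hpx : ∑ j, p j * x j = 0 := by
    have h1 : ∑ i, p i * (∑ j, P i j * x j + ∑ j, p j * x j - x i) = 0 :=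
      Finset.sum_eq_zero fun i _ => by rw [hcoord i, mul_zero]
    simp only [mul_sub, mul_add, Finset.sum_sub_distrib, Finset.sum_add_distrib, hpP,
      ← Finset.sum_mul, hsum] at h1
    linarith
  have hPx : P *ᵥ x = x := by
    funext i
    have := hcoord i
    simp only [Matrix.mulVec, dotProduct]
    linarith
  have hP1 : P *ᵥ 1 = 1 := by
    funext i
    simp [Matrix.mulVec, dotProduct, hrow]
  have hpow : ∀ (y : ι → ℝ), P *ᵥ y = y → ∀ k : ℕ, (P ^ k) *ᵥ y = y := by
    intro y hy k
    induction k with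
    | zero => simp
    | succ k ih => rw [pow_succ, ← Matrix.mulVec_mulVec, hy, ih]
  obtain ⟨k, hk⟩ := hprim
  have hkrow : ∀ i, ∑ j, (P ^ k) i j = 1 := fun i => by
    simpa [Matrix.mulVec, dotProduct] using congrFun (hpow 1 hP1 k) i
  apply hx0
  funext i
  have : ∑ j, p j * x j = x i := by
    rw [Finset.sum_congr rfl fun j _ => by
      rw [eq_of_pos_stochastic_harmonic hk hkrow (hpow x hPx k) j i], ← Finset.sum_mul, hsum,
      one_mul]
  rw [← this, hpx, Pi.zero_apply]

/-- The fundamental matrix solves the Poisson equation for centered functions. -/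
theorem poisson_equation {ι : Type*} [Fintype ι] [DecidableEq ι] [Nonempty ι]
    {P : Matrix ι ι ℝ} (hrow : ∀ i, ∑ j, P i j = 1) (hprim : ∃ k : ℕ, ∀ i j, 0 < (P ^ k) i j)
    {p : ι → ℝ} (hsum : ∑ i, p i = 1) (hstat : ∀ j, ∑ i, p i * P i j = p j)
    {f : ι → ℝ} (hf : ∑ i, p i * f i = 0) {g : ι → ℝ}
    (hg : g = (P + Matrix.of (fun _ j => p j) - 1)⁻¹ *ᵥ f) (i : ι) :
    ∑ j, P i j * g j - g i = f i := by
  have hunit := isUnit_det_add_stationary_sub_one hrow hprim hsum hstat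
  have hMg : (P + Matrix.of (fun _ j => p j) - 1) *ᵥ g = f := by
    rw [hg, Matrix.mulVec_mulVec, Matrix.mul_nonsing_inv _ hunit, Matrix.one_mulVec]
  have hcoord : ∀ i, ∑ j, P i j * g j + ∑ j, p j * g j - g i = f i := by
    intro i
    have := congrFun hMg i
    rw [Matrix.sub_mulVec, Matrix.add_mulVec, Matrix.one_mulVec] at this
    simpa [Matrix.mulVec, dotProduct] using this
  have hpP := sum_stationary_mul_mulVec hstat g
  have h1 : ∑ i, p i * (∑ j, P i j * g j + ∑ j, p j * g j - g i) = 0 := by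
    simp_rw [hcoord, hf]
  simp only [mul_sub, mul_add, Finset.sum_sub_distrib, Finset.sum_add_distrib, hpP,
    ← Finset.sum_mul, hsum] at h1
  have := hcoord i
  linarith

/-- The expectation of a function of a random variable with finitely many values. -/
theorem integral_comp_fintype {Ω α : Type*} [MeasurableSpace Ω] {μ : Measure Ω}
    [IsFiniteMeasure μ] [Fintype α] [MeasurableSpace α] [MeasurableSingletonClass α]
    {Z : Ω → α} (hZ : Measurable Z) (G : α → ℂ) :
    ∫ ω, G (Z ω) ∂μ = ∑ z, (μ.real {ω | Z ω = z} : ℂ) * G z := by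
  have hG : Integrable G (μ.map Z) := Integrable.of_finite
  rw [← integral_map hZ.aemeasurable hG.aestronglyMeasurable, integral_fintype hG]
  refine Finset.sum_congr rfl fun z _ => ?_
  rw [measureReal_def, Measure.map_apply hZ (measurableSet_singleton z), ← measureReal_def]
  simp [Set.preimage]

/-- The Markov property, integrated against a function of the past. -/
theorem markov_integral {Ω : Type*} [MeasurableSpace Ω] {μ : Measure Ω} [IsFiniteMeasure μ]
    {m : ℕ} {P : Matrix (Fin m) (Fin m) ℝ} (hnn : ∀ i j, 0 ≤ P i j)
    {X : ℕ → Ω → Fin m} (hXmeas : ∀ k, Measurable (X k))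
    (hXmarkov : ∀ k : ℕ, 1 ≤ k → ∀ f : ℕ → Fin m,
      μ (⋂ j ∈ Set.Icc 1 (k + 1), {ω | X j ω = f j})
        = μ (⋂ j ∈ Set.Icc 1 k, {ω | X j ω = f j}) * ENNReal.ofReal (P (f k) (f (k + 1))))
    (k : ℕ) (hk : 1 ≤ k) (H : (Finset.Icc 1 k → Fin m) → ℂ) (f : Fin m → ℂ) :
    ∫ ω, H (fun j => X j ω) * f (X (k + 1) ω) ∂μ
      = ∫ ω, H (fun j => X j ω) * ∑ j, (P (X k ω) j : ℂ) * f j ∂μ := by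
  have hY : Measurable fun ω => fun j : Finset.Icc 1 k => X j ω :=
    measurable_pi_lambda _ fun j => hXmeas j
  let last : Finset.Icc 1 k := ⟨k, Finset.mem_Icc.2 ⟨hk, le_rfl⟩⟩
  have hlaw : ∀ (p : Finset.Icc 1 k → Fin m) (j : Fin m),
      μ.real {ω | ((fun i : Finset.Icc 1 k => X i ω), X (k + 1) ω) = (p, j)}
        = μ.real {ω | (fun i : Finset.Icc 1 k => X i ω) = p} * P (p last) j := by
    intro p j
    let φ : ℕ → Fin m := fun i => if h : i ∈ Finset.Icc 1 k then p ⟨i, h⟩ else j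
    have hφ : ∀ i (h : i ∈ Finset.Icc 1 k), φ i = p ⟨i, h⟩ := fun i h => dif_pos h
    have hφ' : φ (k + 1) = j := dif_neg (by simp)
    have e1 : {ω | (fun i : Finset.Icc 1 k => X i ω) = p}
        = ⋂ i ∈ Set.Icc 1 k, {ω | X i ω = φ i} := by
      ext ω
      simp only [Set.mem_ofPred_eq, Set.mem_iInter, funext_iff, Subtype.forall]
      refine forall_congr' fun i => ⟨fun h hi => ?_, fun h hi => ?_⟩
      · rw [hφ i (Finset.mem_Icc.2 hi)]; exact h _
      · rw [h (Finset.mem_Icc.1 hi), hφ i hi]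
    have e2 : {ω | ((fun i : Finset.Icc 1 k => X i ω), X (k + 1) ω) = (p, j)}
        = ⋂ i ∈ Set.Icc 1 (k + 1), {ω | X i ω = φ i} := by
      have : {ω | ((fun i : Finset.Icc 1 k => X i ω), X (k + 1) ω) = (p, j)}
          = {ω | (fun i : Finset.Icc 1 k => X i ω) = p} ∩ {ω | X (k + 1) ω = φ (k + 1)} := by
        ext ω
        simp [hφ', Prod.ext_iff]
      rw [this, e1]
      ext ω
      simp only [Set.mem_inter_iff, Set.mem_iInter, Set.mem_ofPred_eq, Set.mem_Icc]
      constructor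
      · rintro ⟨h1, h2⟩ i ⟨hi1, hi2⟩
        rcases Nat.lt_or_ge k i with h | h
        · obtain rfl : i = k + 1 := by omega
          exact h2
        · exact h1 i ⟨hi1, h⟩
      · exact fun h => ⟨fun i hi => h i ⟨hi.1, by omega⟩, h _ ⟨by omega, le_rfl⟩⟩
    rw [e2, e1, measureReal_def, hXmarkov k hk φ, ENNReal.toReal_mul,
      ENNReal.toReal_ofReal (hnn _ _), hφ', hφ k last.2, measureReal_def]
  have h1 := integral_comp_fintype (μ := μ) (hY.prodMk (hXmeas (k + 1)))
    (fun z => H z.1 * f z.2)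
  have h2 := integral_comp_fintype (μ := μ) hY (fun p => H p * ∑ j, (P (p last) j : ℂ) * f j)
  rw [h1, h2, Fintype.sum_prod_type]
  refine Finset.sum_congr rfl fun p _ => ?_
  simp_rw [Finset.mul_sum]
  refine Finset.sum_congr rfl fun j _ => ?_
  rw [hlaw]
  push_cast
  ring

open Asymptotics Complex in
/-- Second-order expansion of `exp (i θ d) (1 + θ² h / 2)`. -/
theorem exp_mul_I_corrector_isLittleO (d h : ℝ) :
    (fun θ : ℝ => cexp (θ * d * I) * (1 + θ ^ 2 * h / 2)
      - (1 + θ * d * I - θ ^ 2 * d ^ 2 / 2 + θ ^ 2 * h / 2)) =o[𝓝 0] fun θ : ℝ => θ ^ 2 := by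
  have hE : (fun θ : ℝ => cexp (θ * d * I) - (1 + θ * d * I - θ ^ 2 * d ^ 2 / 2))
      =o[𝓝 0] fun θ : ℝ => θ ^ 2 := by
    have hb : (fun θ : ℝ => cexp (θ * d * I) - (1 + θ * d * I - θ ^ 2 * d ^ 2 / 2))
        =O[𝓝 0] fun θ : ℝ => θ ^ 3 := by
      refine IsBigO.of_bound (|d| ^ 3 * Real.exp |d|) ?_
      filter_upwards [Metric.ball_mem_nhds (0 : ℝ) one_pos] with θ hθ
      have hθ1 : |θ| ≤ 1 := by simpa using (Metric.mem_ball.1 hθ).le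
      have := norm_exp_sub_sum_le_norm_mul_exp (θ * d * I) 3
      have hn : ‖(θ * d * I : ℂ)‖ = |θ| * |d| := by simp
      rw [hn] at this
      have e : cexp (θ * d * I) - (1 + θ * d * I - θ ^ 2 * d ^ 2 / 2)
          = cexp (θ * d * I) - ∑ m ∈ range 3, (θ * d * I : ℂ) ^ m / m.factorial := by
        simp only [Finset.sum_range_succ, Finset.sum_range_zero, Nat.factorial]
        push_cast
        linear_combination ((θ * d : ℂ) ^ 2 / 2) * I_sq
      rw [e]
      refine this.trans ?_
      have : |θ| * |d| ≤ |d| := mul_le_of_le_one_left (abs_nonneg _) hθ1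
      calc (|θ| * |d|) ^ 3 * Real.exp (|θ| * |d|) ≤ (|θ| * |d|) ^ 3 * Real.exp |d| := by gcongr
        _ = |d| ^ 3 * Real.exp |d| * ‖θ ^ 3‖ := by
          rw [norm_pow, Real.norm_eq_abs]; ring
    exact hb.trans_isLittleO (isLittleO_pow_pow (by norm_num))
  have h1 : (fun θ : ℝ => (1 + θ ^ 2 * h / 2 : ℂ)) =O[𝓝 0] fun _ => (1 : ℝ) := by
    have : Continuous fun θ : ℝ => (1 + θ ^ 2 * h / 2 : ℂ) := by fun_prop
    exact (this.tendsto 0).isBigO_one ℝ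
  have hA := hE.mul_isBigO h1
  have h2 : (fun θ : ℝ => ((θ * d * I - θ ^ 2 * d ^ 2 / 2) * h / 2 : ℂ)) =o[𝓝 0]
      fun _ => (1 : ℝ) := by
    rw [isLittleO_one_iff]
    have : Continuous fun θ : ℝ => ((θ * d * I - θ ^ 2 * d ^ 2 / 2) * h / 2 : ℂ) := by fun_prop
    simpa using this.tendsto 0
  have h3 : (fun θ : ℝ => (θ ^ 2 : ℂ)) =O[𝓝 0] fun θ : ℝ => θ ^ 2 :=
    IsBigO.of_bound 1 (Eventually.of_forall fun θ => by simp)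
  have hB := h3.mul_isLittleO h2
  simp only [mul_one] at hA hB
  refine (hA.add hB).congr_left fun θ => ?_
  ring

open Asymptotics Complex in
/-- Second-order expansion of `exp (-θ² s / 2) (1 + θ² h / 2)`. -/
theorem exp_neg_sq_corrector_isLittleO (s h : ℝ) :
    (fun θ : ℝ => cexp (-(θ ^ 2 * s / 2)) * (1 + θ ^ 2 * h / 2)
      - (1 - θ ^ 2 * s / 2 + θ ^ 2 * h / 2)) =o[𝓝 0] fun θ : ℝ => θ ^ 2 := by
  have hE : (fun θ : ℝ => cexp (-(θ ^ 2 * s / 2)) - (1 - θ ^ 2 * s / 2))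
      =o[𝓝 0] fun θ : ℝ => θ ^ 2 := by
    have hb : (fun θ : ℝ => cexp (-(θ ^ 2 * s / 2)) - (1 - θ ^ 2 * s / 2))
        =O[𝓝 0] fun θ : ℝ => θ ^ 4 := by
      refine IsBigO.of_bound ((|s| / 2) ^ 2 * Real.exp (|s| / 2)) ?_
      filter_upwards [Metric.ball_mem_nhds (0 : ℝ) one_pos] with θ hθ
      have hθ1 : |θ| ≤ 1 := by simpa using (Metric.mem_ball.1 hθ).le
      have := norm_exp_sub_sum_le_norm_mul_exp (-(θ ^ 2 * s / 2)) 2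
      have hn : ‖(-(θ ^ 2 * s / 2) : ℂ)‖ = |θ| ^ 2 * (|s| / 2) := by simp [mul_div_assoc]
      rw [hn] at this
      have e : cexp (-(θ ^ 2 * s / 2)) - (1 - θ ^ 2 * s / 2)
          = cexp (-(θ ^ 2 * s / 2)) - ∑ m ∈ range 2, (-(θ ^ 2 * s / 2) : ℂ) ^ m / m.factorial := by
        simp only [Finset.sum_range_succ, Finset.sum_range_zero, Nat.factorial]
        push_cast
        ring
      rw [e]
      refine this.trans ?_
      have h2 : |θ| ^ 2 ≤ 1 := pow_le_one₀ (abs_nonneg _) hθ1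
      have : |θ| ^ 2 * (|s| / 2) ≤ |s| / 2 := mul_le_of_le_one_left (by positivity) h2
      calc (|θ| ^ 2 * (|s| / 2)) ^ 2 * Real.exp (|θ| ^ 2 * (|s| / 2))
          ≤ (|θ| ^ 2 * (|s| / 2)) ^ 2 * Real.exp (|s| / 2) := by gcongr
        _ = (|s| / 2) ^ 2 * Real.exp (|s| / 2) * ‖θ ^ 4‖ := by
          rw [norm_pow, Real.norm_eq_abs]; ring
    exact hb.trans_isLittleO (isLittleO_pow_pow (by norm_num))
  have h1 : (fun θ : ℝ => (1 + θ ^ 2 * h / 2 : ℂ)) =O[𝓝 0] fun _ => (1 : ℝ) := by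
    have : Continuous fun θ : ℝ => (1 + θ ^ 2 * h / 2 : ℂ) := by fun_prop
    exact (this.tendsto 0).isBigO_one ℝ
  have hA := hE.mul_isBigO h1
  have h2 : (fun θ : ℝ => (-(θ ^ 2 * s / 2) * h / 2 : ℂ)) =o[𝓝 0] fun _ => (1 : ℝ) := by
    rw [isLittleO_one_iff]
    have : Continuous fun θ : ℝ => (-(θ ^ 2 * s / 2) * h / 2 : ℂ) := by fun_prop
    simpa using this.tendsto 0
  have h3 : (fun θ : ℝ => (θ ^ 2 : ℂ)) =O[𝓝 0] fun θ : ℝ => θ ^ 2 :=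
    IsBigO.of_bound 1 (Eventually.of_forall fun θ => by simp)
  have hB := h3.mul_isLittleO h2
  simp only [mul_one] at hA hB
  refine (hA.add hB).congr_left fun θ => ?_
  ring

open Asymptotics Complex in
/-- The corrected exponential `exp (-iθg) (1 + θ² h / 2)` is an approximate eigenvector, with
eigenvalue `exp (-θ² s / 2)`, of the transfer operator `u ↦ exp (iθb) P u`. -/
theorem transfer_corrector_isLittleO {ι : Type*} [Fintype ι] {P : Matrix ι ι ℝ}
    (hrow : ∀ i, ∑ j, P i j = 1) {b g h w : ι → ℝ} {s : ℝ}
    (hg : ∀ i, ∑ j, P i j * g j - g i = b i) (hh : ∀ i, ∑ j, P i j * h j - h i = w i - s)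
    (hw : ∀ i, w i = ∑ j, P i j * (b i + g i - g j) ^ 2) (i : ι) :
    (fun θ : ℝ => cexp (θ * b i * I) * ∑ j, (P i j : ℂ) *
          (cexp (-(θ * g j * I)) * (1 + θ ^ 2 * h j / 2))
        - cexp (-(θ ^ 2 * s / 2)) * (cexp (-(θ * g i * I)) * (1 + θ ^ 2 * h i / 2)))
      =o[𝓝 0] fun θ : ℝ => θ ^ 2 := by
  have hmain := (IsLittleO.sum (s := Finset.univ) fun j _ =>
    (exp_mul_I_corrector_isLittleO (b i + g i - g j) (h j)).const_mul_left (P i j : ℂ)).sub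
    (exp_neg_sq_corrector_isLittleO s (h i))
  have h1 : (fun θ : ℝ => cexp (-(θ * g i * I))) =O[𝓝 0] fun _ => (1 : ℝ) := by
    refine IsBigO.of_bound 1 (Eventually.of_forall fun θ => ?_)
    have : (-(θ * g i * I) : ℂ) = ((-(θ * g i) : ℝ) : ℂ) * I := by push_cast; ring
    rw [this, norm_exp_ofReal_mul_I]
    simp
  have := h1.mul_isLittleO hmain
  simp only [one_mul] at this
  refine this.congr_left fun θ => ?_
  have r0 : ∑ j, (P i j : ℂ) = 1 := by exact_mod_cast hrow i
  have r1 : ∑ j, (P i j : ℂ) * ((b i + g i - g j : ℝ) : ℂ) = 0 := by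
    have : ∑ j, P i j * (b i + g i - g j) = 0 := by
      simp only [mul_sub, Finset.sum_sub_distrib, ← Finset.sum_mul, hrow]
      linarith [hg i]
    exact_mod_cast this
  have r2 : ∑ j, (P i j : ℂ) * ((b i + g i - g j : ℝ) : ℂ) ^ 2 = w i := by
    exact_mod_cast (hw i).symm
  have r3 : ∑ j, (P i j : ℂ) * (h j : ℂ) = h i + w i - s := by
    have : ∑ j, P i j * h j = h i + w i - s := by linarith [hh i]
    exact_mod_cast this
  have hpoly : ∑ j, (P i j : ℂ) * (1 + θ * ((b i + g i - g j : ℝ) : ℂ) * I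
      - θ ^ 2 * ((b i + g i - g j : ℝ) : ℂ) ^ 2 / 2 + θ ^ 2 * h j / 2)
      = (1 - θ ^ 2 * s / 2 + θ ^ 2 * h i / 2 : ℂ) := by
    have : ∀ j, (P i j : ℂ) * (1 + θ * ((b i + g i - g j : ℝ) : ℂ) * I
      - θ ^ 2 * ((b i + g i - g j : ℝ) : ℂ) ^ 2 / 2 + θ ^ 2 * h j / 2)
      = (P i j : ℂ) + θ * I * ((P i j : ℂ) * ((b i + g i - g j : ℝ) : ℂ))
        - θ ^ 2 / 2 * ((P i j : ℂ) * ((b i + g i - g j : ℝ) : ℂ) ^ 2)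
        + θ ^ 2 / 2 * ((P i j : ℂ) * h j) := fun j => by ring
    simp_rw [this, Finset.sum_add_distrib, Finset.sum_sub_distrib, Finset.sum_add_distrib,
      ← Finset.mul_sum, r0, r1, r2, r3]
    ring
  have hsplit : ∀ j, cexp (-(θ * g i * I)) * cexp (θ * ((b i + g i - g j : ℝ) : ℂ) * I)
      = cexp (θ * b i * I) * cexp (-(θ * g j * I)) := fun j => by
    rw [← Complex.exp_add, ← Complex.exp_add]
    congr 1
    push_cast
    ring
  simp_rw [mul_sub (P i _ : ℂ)]
  rw [Finset.sum_apply, Finset.sum_sub_distrib, hpoly]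
  rw [sub_sub_sub_cancel_right, mul_sub, Finset.mul_sum, Finset.mul_sum]
  congr 1
  · refine Finset.sum_congr rfl fun j _ => ?_
    linear_combination (P i j : ℂ) * (1 + θ ^ 2 * h j / 2) * hsplit j
  · ring

open Complex in
/-- Uniform approximation of the characteristic functions of the partial sums of `b` along a Markov
chain, where `g` solves the Poisson equation for `b` and `h` the one for the conditional
variances. -/
theorem eventually_norm_charFun_sum_sub_le {Ω : Type*} [MeasurableSpace Ω] {μ : Measure Ω}
    [IsProbabilityMeasure μ] {m : ℕ} {P : Matrix (Fin m) (Fin m) ℝ} (hnn : ∀ i j, 0 ≤ P i j)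
    (hrow : ∀ i, ∑ j, P i j = 1) {X : ℕ → Ω → Fin m} (hXmeas : ∀ k, Measurable (X k))
    (hXmarkov : ∀ k : ℕ, 1 ≤ k → ∀ f : ℕ → Fin m,
      μ (⋂ j ∈ Set.Icc 1 (k + 1), {ω | X j ω = f j})
        = μ (⋂ j ∈ Set.Icc 1 k, {ω | X j ω = f j}) * ENNReal.ofReal (P (f k) (f (k + 1))))
    {b g h w : Fin m → ℝ} {s : ℝ} (hs : 0 ≤ s)
    (hg : ∀ i, ∑ j, P i j * g j - g i = b i) (hh : ∀ i, ∑ j, P i j * h j - h i = w i - s)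
    (hw : ∀ i, w i = ∑ j, P i j * (b i + g i - g j) ^ 2) {ε : ℝ} (hε : 0 < ε) :
    ∀ᶠ θ : ℝ in 𝓝 0, ∀ k : ℕ,
      ‖∫ ω, cexp ((θ * ∑ j ∈ Finset.Icc 1 k, b (X j ω) : ℝ) * I) ∂μ
        - cexp (-(θ ^ 2 * s / 2)) ^ k‖ ≤ ε * (1 + k * θ ^ 2) := by
  let u : ℝ → Fin m → ℂ := fun θ i => cexp (-(θ * g i * I)) * (1 + θ ^ 2 * h i / 2)
  have hu : ∀ᶠ θ : ℝ in 𝓝 0, ∀ i, ‖1 - u θ i‖ ≤ ε / 2 := by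
    rw [eventually_all]
    intro i
    have hc : Continuous fun θ : ℝ => ‖1 - u θ i‖ := by
      simp only [u]
      fun_prop
    have h0 : ‖1 - u 0 i‖ = 0 := by simp [u]
    have := hc.tendsto 0
    rw [h0] at this
    exact this.eventually_le_const (by positivity)
  have hR : ∀ᶠ θ : ℝ in 𝓝 0, ∀ i, ‖cexp (θ * b i * I) * ∑ j, (P i j : ℂ) * u θ j
      - cexp (-(θ ^ 2 * s / 2)) * u θ i‖ ≤ ε * θ ^ 2 := by
    rw [eventually_all]
    intro i
    filter_upwards [(transfer_corrector_isLittleO hrow hg hh hw i).bound hε] with θ hθ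
    simpa [u] using hθ
  filter_upwards [hu, hR] with θ huθ hRθ k
  set z : ℂ := cexp (-(θ ^ 2 * s / 2)) with hz
  have hz1 : ‖z‖ ≤ 1 := by
    have : (-(θ ^ 2 * s / 2) : ℂ) = ((-(θ ^ 2 * s / 2) : ℝ) : ℂ) := by push_cast; ring
    rw [hz, this, Complex.norm_exp_ofReal, Real.exp_le_one_iff]
    have : 0 ≤ θ ^ 2 * s / 2 := by positivity
    linarith
  let e : ℕ → Ω → ℂ := fun k ω => cexp ((θ * ∑ j ∈ Finset.Icc 1 k, b (X j ω) : ℝ) * I)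
  have he1 : ∀ k ω, ‖e k ω‖ = 1 := fun k ω => norm_exp_ofReal_mul_I _
  have hfm : ∀ (F : Fin m → ℂ) k, Measurable fun ω => F (X k ω) := fun F k =>
    (measurable_of_finite F).comp (hXmeas k)
  have hem : ∀ k, Measurable (e k) := by
    intro k
    have h1 : ∀ j, Measurable fun ω => b (X j ω) := fun j =>
      (measurable_of_finite b).comp (hXmeas j)
    have h2 : Measurable fun ω => ∑ j ∈ Finset.Icc 1 k, b (X j ω) :=
      Finset.measurable_fun_sum _ fun j _ => h1 j
    simp only [e]
    fun_prop
  have hint : ∀ k l (F : Fin m → ℂ), Integrable (fun ω => e k ω * F (X l ω)) μ := by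
    intro k l F
    obtain ⟨C, hC⟩ := Finite.exists_le fun i => ‖F i‖
    refine Integrable.of_bound ((hem k).mul (hfm F l)).aestronglyMeasurable C
      (Eventually.of_forall fun ω => ?_)
    rw [norm_mul, he1, one_mul]
    exact hC _
  have hinte : ∀ k, Integrable (e k) μ := fun k => by simpa using hint k 0 fun _ => 1
  have hbound : ∀ (F : Ω → ℂ) (C : ℝ), (∀ ω, ‖F ω‖ ≤ C) → ‖∫ ω, F ω ∂μ‖ ≤ C := by
    intro F C hF
    simpa using norm_integral_le_of_norm_le_const (μ := μ) (Eventually.of_forall hF)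
  have hstep : ∀ k, ‖∫ ω, e (k + 1) ω * u θ (X (k + 2) ω) ∂μ
      - z * ∫ ω, e k ω * u θ (X (k + 1) ω) ∂μ‖ ≤ ε * θ ^ 2 := by
    intro k
    have hM := markov_integral (μ := μ) hnn hXmeas hXmarkov (k + 1) (by omega)
      (fun p => cexp ((θ * ∑ j, b (p j) : ℝ) * I)) (u θ)
    have hsum : ∀ ω, ∑ j : Finset.Icc 1 (k + 1), b (X j ω)
        = ∑ j ∈ Finset.Icc 1 (k + 1), b (X j ω) := fun ω =>
      Finset.sum_coe_sort (Finset.Icc 1 (k + 1)) fun j => b (X j ω)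
    simp only [hsum] at hM
    have hM' : ∫ ω, e (k + 1) ω * u θ (X (k + 2) ω) ∂μ
        = ∫ ω, e k ω * (cexp (θ * b (X (k + 1) ω) * I)
          * ∑ j, (P (X (k + 1) ω) j : ℂ) * u θ j) ∂μ := by
      refine hM.trans (integral_congr_ae (Eventually.of_forall fun ω => ?_))
      simp only [e]
      rw [Finset.sum_Icc_succ_top (by omega), ← mul_assoc, ← Complex.exp_add]
      congr 2
      push_cast
      ring
    rw [hM', ← integral_const_mul, ← integral_sub
      (hint k (k + 1) fun i => cexp (θ * b i * I) * ∑ j, (P i j : ℂ) * u θ j)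
      ((hint k (k + 1) (u θ)).const_mul z)]
    refine hbound _ _ fun ω => ?_
    rw [mul_left_comm z, ← mul_sub, norm_mul, he1, one_mul]
    exact hRθ _
  have hiter : ∀ k : ℕ, ‖∫ ω, e k ω * u θ (X (k + 1) ω) ∂μ - z ^ k * ∫ ω, u θ (X 1 ω) ∂μ‖
      ≤ k * (ε * θ ^ 2) := by
    intro k
    induction k with
    | zero => simp [e]
    | succ k ih =>
      have : ∫ ω, e (k + 1) ω * u θ (X (k + 2) ω) ∂μ - z ^ (k + 1) * ∫ ω, u θ (X 1 ω) ∂μ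
          = (∫ ω, e (k + 1) ω * u θ (X (k + 2) ω) ∂μ - z * ∫ ω, e k ω * u θ (X (k + 1) ω) ∂μ)
          + z * (∫ ω, e k ω * u θ (X (k + 1) ω) ∂μ - z ^ k * ∫ ω, u θ (X 1 ω) ∂μ) := by ring
      rw [this]
      refine (norm_add_le _ _).trans ?_
      rw [norm_mul z]
      have h2 := mul_le_of_le_one_left (norm_nonneg
        (∫ ω, e k ω * u θ (X (k + 1) ω) ∂μ - z ^ k * ∫ ω, u θ (X 1 ω) ∂μ)) hz1
      push_cast
      linarith [hstep k]
  have hfirst : ‖∫ ω, e k ω ∂μ - ∫ ω, e k ω * u θ (X (k + 1) ω) ∂μ‖ ≤ ε / 2 := by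
    rw [← integral_sub (hinte k) (hint k (k + 1) (u θ))]
    refine hbound _ _ fun ω => ?_
    rw [← mul_one_sub, norm_mul, he1, one_mul]
    exact huθ _
  have hlast : ‖z ^ k * ∫ ω, u θ (X 1 ω) ∂μ - z ^ k‖ ≤ ε / 2 := by
    have hi : Integrable (fun ω => u θ (X 1 ω)) μ := by simpa [e] using hint 0 1 (u θ)
    have h1 : ‖∫ ω, u θ (X 1 ω) ∂μ - 1‖ ≤ ε / 2 := by
      have : ∫ ω, u θ (X 1 ω) ∂μ - 1 = ∫ ω, (u θ (X 1 ω) - 1) ∂μ := by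
        rw [integral_sub hi (integrable_const _)]
        simp
      rw [this]
      refine hbound _ _ fun ω => ?_
      rw [norm_sub_rev]
      exact huθ _
    rw [← mul_sub_one, norm_mul, norm_pow]
    exact (mul_le_of_le_one_left (norm_nonneg _) (pow_le_one₀ (norm_nonneg _) hz1)).trans h1
  have hsplit : ∫ ω, e k ω ∂μ - z ^ k
      = (∫ ω, e k ω ∂μ - ∫ ω, e k ω * u θ (X (k + 1) ω) ∂μ)
      + (∫ ω, e k ω * u θ (X (k + 1) ω) ∂μ - z ^ k * ∫ ω, u θ (X 1 ω) ∂μ)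
      + (z ^ k * ∫ ω, u θ (X 1 ω) ∂μ - z ^ k) := by ring
  calc ‖∫ ω, e k ω ∂μ - z ^ k‖ ≤ ε / 2 + k * (ε * θ ^ 2) + ε / 2 := by
        rw [hsplit]
        exact norm_add₃_le.trans (add_le_add_three hfirst (hiter k) hlast)
    _ = ε * (1 + k * θ ^ 2) := by ring

/-- The expectation of a function of two independent random variables, the first of them with values
in `ℕ`, is an iterated expectation. -/
theorem integral_comp_of_indepFun_nat {Ω β : Type*} [MeasurableSpace Ω] [MeasurableSpace β]
    {μ : Measure Ω} [IsProbabilityMeasure μ] {K : Ω → ℕ} {Y : Ω → β} (hK : Measurable K)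
    (hY : Measurable Y) (hind : IndepFun K Y μ) {G : ℕ → β → ℂ} (hG : ∀ k, Measurable (G k))
    {C : ℝ} (hC : ∀ k y, ‖G k y‖ ≤ C) :
    ∫ ω, G (K ω) (Y ω) ∂μ = ∫ ω, (∫ ω', G (K ω) (Y ω') ∂μ) ∂μ := by
  have hGm : Measurable fun q : ℕ × β => G q.1 q.2 := measurable_from_prod_countable_right hG
  have hmap := (indepFun_iff_map_prod_eq_prod_map_map hK.aemeasurable hY.aemeasurable).1 hind
  have := Measure.isProbabilityMeasure_map (μ := μ) hK.aemeasurable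
  have := Measure.isProbabilityMeasure_map (μ := μ) hY.aemeasurable
  have hint : Integrable (fun q : ℕ × β => G q.1 q.2) ((μ.map K).prod (μ.map Y)) :=
    Integrable.of_bound hGm.aestronglyMeasurable C (Eventually.of_forall fun q => hC _ _)
  calc ∫ ω, G (K ω) (Y ω) ∂μ = ∫ q, G q.1 q.2 ∂(μ.map fun ω => (K ω, Y ω)) :=
        (integral_map (hK.prodMk hY).aemeasurable hGm.aestronglyMeasurable).symm
    _ = ∫ k, ∫ y, G k y ∂(μ.map Y) ∂(μ.map K) := by rw [hmap, integral_prod _ hint]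
    _ = ∫ ω, ∫ y, G (K ω) y ∂(μ.map Y) ∂μ :=
        integral_map hK.aemeasurable (measurable_of_countable _).aestronglyMeasurable
    _ = ∫ ω, (∫ ω', G (K ω) (Y ω') ∂μ) ∂μ := by
        refine integral_congr_ae (Eventually.of_forall fun ω => ?_)
        exact integral_map hY.aemeasurable (hG _).aestronglyMeasurable

/-- Convergence of characteristic functions of real random variables to a Gaussian characteristic
function implies convergence in distribution, along a sequence. -/
theorem tendsto_integral_of_tendsto_charFun_gaussian {Ω : Type*} [MeasurableSpace Ω]
    {μ : Measure Ω} [IsProbabilityMeasure μ] {Z : ℕ → Ω → ℝ} (hZ : ∀ n, Measurable (Z n))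
    {V : ℝ} (hV : 0 ≤ V)
    (hlim : ∀ s : ℝ, Tendsto (fun n => ∫ ω, Complex.exp ((s * Z n ω : ℝ) * Complex.I) ∂μ) atTop
      (𝓝 (Complex.exp (-(V * s ^ 2 / 2)))))
    (F : BoundedContinuousFunction ℝ ℝ) :
    Tendsto (fun n => ∫ ω, F (Z n ω) ∂μ) atTop
      (𝓝 (∫ x, F x ∂(gaussianReal 0 (Real.toNNReal V)))) := by
  let ν : ℕ → ProbabilityMeasure ℝ := fun n =>
    ⟨μ.map (Z n), Measure.isProbabilityMeasure_map (hZ n).aemeasurable⟩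
  let ν₀ : ProbabilityMeasure ℝ := ⟨gaussianReal 0 (Real.toNNReal V), inferInstance⟩
  have hν : Tendsto ν atTop (𝓝 ν₀) := by
    refine ProbabilityMeasure.tendsto_of_tendsto_charFun fun s => ?_
    have h1 : charFun (ν₀ : Measure ℝ) s = Complex.exp (-(V * s ^ 2 / 2)) := by
      change charFun (gaussianReal 0 (Real.toNNReal V)) s = _
      rw [charFun_gaussianReal]
      simp [Real.coe_toNNReal V hV]
    have h2 : ∀ n, charFun (ν n : Measure ℝ) s
        = ∫ ω, Complex.exp ((s * Z n ω : ℝ) * Complex.I) ∂μ := by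
      intro n
      change charFun (μ.map (Z n)) s = _
      rw [charFun_apply_real, integral_map (hZ n).aemeasurable (by fun_prop)]
      simp
    simp_rw [h1, h2]
    exact hlim s
  have := ProbabilityMeasure.tendsto_iff_forall_integral_tendsto.1 hν F
  refine this.congr fun n => ?_
  exact integral_map (hZ n).aemeasurable F.continuous.measurable.aestronglyMeasurable

/-- A uniform approximation `φ θ k ≈ exp (-k θ² s / 2)` near `θ = 0` passes to the limit along
sequences `θ n → 0` and `K n` with `K n * (θ n)² → L`. -/
theorem tendsto_exp_of_uniform_approx {φ : ℝ → ℕ → ℂ} {s : ℝ}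
    (hφ : ∀ ε : ℝ, 0 < ε → ∀ᶠ θ : ℝ in 𝓝 0, ∀ k : ℕ,
      ‖φ θ k - Complex.exp (-(θ ^ 2 * s / 2)) ^ k‖ ≤ ε * (1 + k * θ ^ 2))
    {θ : ℕ → ℝ} (hθ : Tendsto θ atTop (𝓝 0)) {K : ℕ → ℕ} {L : ℝ}
    (hK : Tendsto (fun n => (K n : ℝ) * θ n ^ 2) atTop (𝓝 L)) :
    Tendsto (fun n => φ (θ n) (K n)) atTop (𝓝 (Complex.exp (-(L * s / 2)))) := by
  have hL : 0 ≤ L := ge_of_tendsto' hK fun n => by positivity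
  have hexp : Tendsto (fun n => Complex.exp (-((θ n : ℂ) ^ 2 * s / 2)) ^ K n) atTop
      (𝓝 (Complex.exp (-(L * s / 2)))) := by
    have hc : Continuous fun x : ℝ => Complex.exp (-((x : ℂ) * s / 2)) := by fun_prop
    refine ((hc.tendsto L).comp hK).congr fun n => ?_
    rw [← Complex.exp_nat_mul, Function.comp_apply]
    congr 1
    push_cast
    ring
  have hdiff : Tendsto (fun n => φ (θ n) (K n) - Complex.exp (-((θ n : ℂ) ^ 2 * s / 2)) ^ K n)
      atTop (𝓝 0) := by
    rw [Metric.tendsto_nhds]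
    intro ε hε
    have hε' : 0 < ε / (2 * (L + 2)) := by positivity
    filter_upwards [hθ.eventually (hφ _ hε'), hK.eventually_le_const (lt_add_one L)] with n h1 h2
    rw [dist_zero_right]
    calc _ ≤ ε / (2 * (L + 2)) * (1 + K n * θ n ^ 2) := h1 _
      _ ≤ ε / (2 * (L + 2)) * (L + 2) := mul_le_mul_of_nonneg_left (by linarith) hε'.le
      _ = ε / 2 := by field_simp
      _ < ε := by linarith
  simpa using hdiff.add hexp

/-- Diffusion limit for the general compound Hawkes process with n-state
dependent orders (Theorems "Diffusion Limit for NLCHPnSDO" and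
"Diffusion limit for GCHPnSDO"): for every `t > 0`,
`(S_{nt} - N_{nt} a*)/√n` converges in distribution to a centered Gaussian
with variance `(σ*)² c t`. -/
theorem diffusion_limit_GCHPnSDO
    {Ω : Type*} [MeasurableSpace Ω] (Pr : Measure Ω) [IsProbabilityMeasure Pr]
    (m : ℕ) (hm : 1 ≤ m)
    (P : Matrix (Fin m) (Fin m) ℝ)
    (hPnn : ∀ i j, 0 ≤ P i j)
    (hProw : ∀ i, ∑ j, P i j = 1)
    (hPprim : ∃ k : ℕ, ∀ i j, 0 < (P ^ k) i j)
    (π : Fin m → ℝ)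
    (hπpos : ∀ i, 0 < π i) (hπsum : ∑ i, π i = 1)
    (hπstat : ∀ j, ∑ i, π i * P i j = π j)
    (X : ℕ → Ω → Fin m)
    (hXmeas : ∀ k, Measurable (X k))
    (hXmarkov : ∀ k : ℕ, 1 ≤ k → ∀ f : ℕ → Fin m,
      Pr (⋂ j ∈ Set.Icc 1 (k + 1), {ω | X j ω = f j})
        = Pr (⋂ j ∈ Set.Icc 1 k, {ω | X j ω = f j}) * ENNReal.ofReal (P (f k) (f (k + 1))))
    (a : Fin m → ℝ)
    (astar : ℝ) (hastar : astar = ∑ i, π i * a i)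
    (b : Fin m → ℝ) (hb : ∀ i, b i = a i - astar)
    (g : Fin m → ℝ) (hg : g = (P + Matrix.of (fun _ j => π j) - 1)⁻¹ *ᵥ b)
    (v : Fin m → ℝ)
    (hv : ∀ i, v i = (b i) ^ 2 + ∑ j, (g j - g i) ^ 2 * P i j
        - 2 * b i * ∑ j, (g j - g i) * P i j)
    (σ2 : ℝ) (hσ2 : σ2 = ∑ i, π i * v i)
    (N : ℝ → Ω → ℕ)
    (hNmeas : ∀ t, Measurable (N t))
    (hN0 : ∀ ω, N 0 ω = 0)
    (hNmono : ∀ ω, Monotone (fun t => N t ω))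
    (hNrc : ∀ ω t, ContinuousWithinAt (fun s => (N s ω : ℝ)) (Set.Ici t) t)
    (c : ℝ) (hc : 0 < c)
    (hNLLN : ∀ᵐ ω ∂Pr, Tendsto (fun t : ℝ => (N t ω : ℝ) / t) atTop (𝓝 c))
    (hindep : IndepFun (fun ω (t : ℝ) => N t ω) (fun ω (k : ℕ) => X k ω) Pr)
    (S0 : ℝ) (S : ℝ → Ω → ℝ)
    (hS : ∀ t ω, S t ω = S0 + ∑ k ∈ Finset.Icc 1 (N t ω), a (X k ω))
    (t : ℝ) (ht : 0 < t) :
    ∀ F : BoundedContinuousFunction ℝ ℝ,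
      Tendsto (fun n : ℕ =>
          ∫ ω, F ((S (n * t) ω - (N (n * t) ω : ℝ) * astar) / Real.sqrt n) ∂Pr)
        atTop
        (𝓝 (∫ x, F x ∂(gaussianReal 0 (Real.toNNReal (σ2 * c * t))))) := by
  intro F
  have : Nonempty (Fin m) := ⟨⟨0, hm⟩⟩
  have hbmean : ∑ i, π i * b i = 0 := by
    simp only [hb, mul_sub, Finset.sum_sub_distrib, ← Finset.sum_mul, hπsum, hastar]
    ring
  have hgP := poisson_equation hProw hPprim hπsum hπstat hbmean hg
  have hvP : ∀ i, v i = ∑ j, P i j * (b i + g i - g j) ^ 2 := by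
    intro i
    have : ∀ j, P i j * (b i + g i - g j) ^ 2 = P i j * b i ^ 2 + (g j - g i) ^ 2 * P i j
        - 2 * b i * ((g j - g i) * P i j) := fun j => by ring
    simp_rw [this]
    rw [Finset.sum_sub_distrib, Finset.sum_add_distrib, ← Finset.sum_mul, hProw i, one_mul,
      ← Finset.mul_sum, hv i]
  have hσ0 : 0 ≤ σ2 := by
    rw [hσ2]
    refine Finset.sum_nonneg fun i _ => mul_nonneg (hπpos i).le ?_
    rw [hvP i]
    exact Finset.sum_nonneg fun j _ => mul_nonneg (hPnn i j) (sq_nonneg _)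
  have hvmean : ∑ i, π i * (v i - σ2) = 0 := by
    simp only [mul_sub, Finset.sum_sub_distrib, ← Finset.sum_mul, hπsum, hσ2]
    ring
  have hhP := poisson_equation hProw hPprim hπsum hπstat hvmean rfl
  have hφ := fun (ε : ℝ) (hε : 0 < ε) => eventually_norm_charFun_sum_sub_le (μ := Pr) hPnn hProw
    hXmeas hXmarkov hσ0 hgP hhP hvP hε
  have hXseq : Measurable fun ω (k : ℕ) => X k ω := measurable_pi_lambda _ hXmeas
  have hcoord : ∀ j, Measurable fun y : ℕ → Fin m => b (y j) := fun j =>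
    (measurable_of_finite b).comp (measurable_pi_apply j)
  have hsum : ∀ k, Measurable fun y : ℕ → Fin m => ∑ j ∈ Finset.Icc 1 k, b (y j) := fun k =>
    Finset.measurable_fun_sum _ fun j _ => hcoord j
  have hcenter : ∀ r ω, S r ω - (N r ω : ℝ) * astar
      = S0 + ∑ j ∈ Finset.Icc 1 (N r ω), b (X j ω) := by
    intro r ω
    rw [hS]
    simp only [hb, Finset.sum_sub_distrib, Finset.sum_const, Nat.card_Icc, nsmul_eq_mul]
    push_cast
    ring
  simp_rw [hcenter]
  have hpair : ∀ r, Measurable fun ω => S0 + ∑ j ∈ Finset.Icc 1 (N r ω), b (X j ω) := by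
    intro r
    have : Measurable fun q : ℕ × (ℕ → Fin m) => S0 + ∑ j ∈ Finset.Icc 1 q.1, b (q.2 j) :=
      measurable_from_prod_countable_right fun k => (hsum k).const_add S0
    exact this.comp ((hNmeas r).prodMk hXseq)
  refine tendsto_integral_of_tendsto_charFun_gaussian (μ := Pr)
    (Z := fun n ω => (S0 + ∑ j ∈ Finset.Icc 1 (N (n * t) ω), b (X j ω)) / Real.sqrt n)
    (fun n => (hpair _).div_const _)
    (mul_nonneg (mul_nonneg hσ0 hc.le) ht.le) (fun s => ?_) F
  let G : ℕ → ℕ → (ℕ → Fin m) → ℂ := fun n k y =>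
    Complex.exp ((s * ((S0 + ∑ j ∈ Finset.Icc 1 k, b (y j)) / Real.sqrt n) : ℝ) * Complex.I)
  have hG1 : ∀ n k y, ‖G n k y‖ ≤ 1 := fun n k y => (Complex.norm_exp_ofReal_mul_I _).le
  have hGm : ∀ n k, Measurable (G n k) := by
    intro n k
    have := hsum k
    simp only [G]
    fun_prop
  have hiter : ∀ n : ℕ, ∫ ω, G n (N (n * t) ω) (fun k => X k ω) ∂Pr
      = ∫ ω, (∫ ω', G n (N (n * t) ω) (fun k => X k ω') ∂Pr) ∂Pr := fun n =>
    integral_comp_of_indepFun_nat (hNmeas _) hXseq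
      (hindep.comp (measurable_pi_apply (n * t : ℝ)) measurable_id) (hGm n) (hG1 n)
  refine Tendsto.congr (fun n => (hiter n).symm) ?_
  have hconst : ∫ _ω, Complex.exp (-((σ2 * c * t : ℝ) * s ^ 2 / 2)) ∂Pr
      = Complex.exp (-((σ2 * c * t : ℝ) * s ^ 2 / 2)) := by simp
  rw [← hconst]
  refine tendsto_integral_of_dominated_convergence (fun _ => (1 : ℝ))
    (fun n => ?_) (integrable_const _) (fun n => Eventually.of_forall fun ω => ?_) ?_
  · exact ((measurable_of_countable fun k => ∫ ω', G n k (fun k => X k ω') ∂Pr).comp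
      (hNmeas (n * t))).aestronglyMeasurable
  · simpa using norm_integral_le_of_norm_le_const (μ := Pr)
      (Eventually.of_forall fun ω' => hG1 n (N (n * t) ω) fun k => X k ω')
  have hsqrt : Tendsto (fun n : ℕ => Real.sqrt n) atTop atTop :=
    Real.tendsto_sqrt_atTop.comp tendsto_natCast_atTop_atTop
  have hθ : Tendsto (fun n : ℕ => s / Real.sqrt n) atTop (𝓝 0) := hsqrt.const_div_atTop s
  filter_upwards [hNLLN] with ω hω
  have hK : Tendsto (fun n : ℕ => (N (n * t) ω : ℝ) * (s / Real.sqrt n) ^ 2) atTop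
      (𝓝 (c * t * s ^ 2)) := by
    have hnt : Tendsto (fun n : ℕ => (n : ℝ) * t) atTop atTop :=
      tendsto_natCast_atTop_atTop.atTop_mul_const ht
    refine (((hω.comp hnt).mul_const t).mul_const (s ^ 2)).congr' ?_
    filter_upwards [eventually_gt_atTop 0] with n hn
    have hn' : (n : ℝ) ≠ 0 := by positivity
    rw [Function.comp_apply, div_pow, Real.sq_sqrt (Nat.cast_nonneg n)]
    field_simp
  have h1 := tendsto_exp_of_uniform_approx hφ hθ hK
  have h2 : Tendsto (fun n : ℕ => Complex.exp ((s / Real.sqrt n * S0 : ℝ) * Complex.I)) atTop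
      (𝓝 1) := by
    have hc : Continuous fun x : ℝ => Complex.exp ((x * S0 : ℝ) * Complex.I) := by fun_prop
    simpa [Function.comp_def] using (hc.tendsto 0).comp hθ
  have h3 := h2.mul h1
  have hlim : (1 : ℂ) * Complex.exp (-((c * t * s ^ 2 : ℝ) * σ2 / 2))
      = Complex.exp (-((σ2 * c * t : ℝ) * s ^ 2 / 2)) := by
    rw [one_mul]
    congr 1
    push_cast
    ring
  rw [hlim] at h3
  refine h3.congr fun n => ?_
  rw [← integral_const_mul]
  refine integral_congr_ae (Eventually.of_forall fun ω' => ?_)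
  simp only [G]
  rw [← Complex.exp_add]
  congr 1
  push_cast
  ring
end

section
/- Law of Large Numbers for the general compound Hawkes process with n-state dependent orders (covers the Lemmas 'LLN for NLCHPnSDO' and 'LLN for GCHPnSDO'): For every t ≥ 0, S_{nt}/n converges almost surely, as n → ∞, to a*·c·t. -/
open MeasureTheory ProbabilityTheory Filter Finset Matrix Topology

/-- A harmonic vector of a primitive row-stochastic matrix is constant. -/
theorem eq_of_mulVec_eq_self_of_primitive {ι : Type*} [Fintype ι] [DecidableEq ι]
    {P : Matrix ι ι ℝ} (hrow : ∀ i, ∑ j, P i j = 1) {k : ℕ} (hk : ∀ i j, 0 < (P ^ k) i j)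
    {h : ι → ℝ} (hh : P *ᵥ h = h) (x y : ι) : h x = h y := by
  have hpow : ∀ v : ι → ℝ, P *ᵥ v = v → ∀ r : ℕ, (P ^ r) *ᵥ v = v := by
    intro v hv r
    induction r with
    | zero => simp
    | succ r ih => rw [pow_succ, ← mulVec_mulVec, hv, ih]
  have hone : P *ᵥ (fun _ => 1) = fun _ => 1 := by
    ext i
    simp [mulVec, dotProduct, hrow]
  have : Nonempty ι := ⟨x⟩
  obtain ⟨i, hi⟩ := Finite.exists_max h
  have hzero : ∑ j, (P ^ k) i j * (h i - h j) = 0 := by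
    have h1 := congrFun (hpow h hh k) i
    have h2 := congrFun (hpow _ hone k) i
    simp only [mulVec, dotProduct, mul_one] at h1 h2
    simp only [mul_sub, sum_sub_distrib, h1, ← sum_mul, h2]
    ring
  have hterm := (sum_eq_zero_iff_of_nonneg
    (fun j _ => mul_nonneg (hk i j).le (sub_nonneg.2 (hi j)))).1 hzero
  have hmax : ∀ j, h j = h i := fun j => by
    rcases mul_eq_zero.1 (hterm j (mem_univ j)) with h0 | h0
    · exact absurd h0 (hk i j).ne'
    · linarith
  rw [hmax x, hmax y]

/-- Solvability of the Poisson equation `g - P g = a - π a` for a primitive stochastic matrix. -/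
theorem exists_poisson_solution {ι : Type*} [Fintype ι] [DecidableEq ι]
    {P : Matrix ι ι ℝ} (hrow : ∀ i, ∑ j, P i j = 1) {k : ℕ} (hk : ∀ i j, 0 < (P ^ k) i j)
    {π : ι → ℝ} (hsum : ∑ i, π i = 1) (hstat : ∀ j, ∑ i, π i * P i j = π j) (a : ι → ℝ) :
    ∃ g : ι → ℝ, ∀ i, g i - ∑ j, P i j * g j = a i - ∑ j, π j * a j := by
  have hstat' : π ᵥ* P = π := funext hstat
  have hπP : ∀ v, π ⬝ᵥ (P *ᵥ v) = π ⬝ᵥ v := fun v => by rw [dotProduct_mulVec, hstat']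
  have hπc : ∀ r : ℝ, π ⬝ᵥ (fun _ => r) = r := fun r => by
    simp [dotProduct, ← sum_mul, hsum]
  let A : (ι → ℝ) →ₗ[ℝ] (ι → ℝ) :=
    { toFun := fun v => v - P *ᵥ v + fun _ => π ⬝ᵥ v
      map_add' := fun v w => by
        ext i
        simp only [mulVec_add, dotProduct_add, Pi.add_apply, Pi.sub_apply]
        ring
      map_smul' := fun r v => by
        ext i
        simp only [mulVec_smul, dotProduct_smul, Pi.add_apply, Pi.sub_apply, Pi.smul_apply,
          smul_eq_mul, RingHom.id_apply]
        ring }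
  have hA : ∀ v, A v = v - P *ᵥ v + fun _ => π ⬝ᵥ v := fun _ => rfl
  have hπA : ∀ v, π ⬝ᵥ A v = π ⬝ᵥ v := fun v => by
    rw [hA, dotProduct_add, dotProduct_sub, hπP, hπc, sub_self, zero_add]
  have hinj : Function.Injective A := by
    rw [injective_iff_map_eq_zero]
    intro v hv
    have h0 : π ⬝ᵥ v = 0 := by rw [← hπA, hv, dotProduct_zero]
    have hharm : P *ᵥ v = v := by
      have hv' := hA v
      rw [hv, h0] at hv'
      ext i
      have := congrFun hv' i
      simp only [Pi.zero_apply, Pi.add_apply, Pi.sub_apply] at this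
      linarith
    ext i
    have hc : v = fun _ => v i :=
      funext fun j => eq_of_mulVec_eq_self_of_primitive hrow hk hharm j i
    rw [hc, hπc] at h0
    exact h0
  obtain ⟨g, hg⟩ := LinearMap.injective_iff_surjective.1 hinj (a - fun _ => π ⬝ᵥ a)
  have hg0 : π ⬝ᵥ g = 0 := by rw [← hπA, hg, dotProduct_sub, hπc, sub_self]
  refine ⟨g, fun i => ?_⟩
  have := congrFun (hA g ▸ hg) i
  rw [hg0] at this
  simpa [mulVec, dotProduct] using this

/-- One-step conditional expectation of a finite Markov chain, tested against a function of the
path up to time `k`. -/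
theorem integral_path_mul_next {Ω ι : Type*} [MeasurableSpace Ω] {μ : Measure Ω}
    [IsProbabilityMeasure μ] [Fintype ι] [Nonempty ι] [MeasurableSpace ι]
    [MeasurableSingletonClass ι] {P : Matrix ι ι ℝ} (hnn : ∀ i j, 0 ≤ P i j)
    (hrow : ∀ i, ∑ j, P i j = 1) {X : ℕ → Ω → ι} (hX : ∀ k, Measurable (X k)) {k : ℕ} (hk : 1 ≤ k)
    (hmarkov : ∀ f : ℕ → ι, μ (⋂ j ∈ Set.Icc 1 (k + 1), {ω | X j ω = f j})
      = μ (⋂ j ∈ Set.Icc 1 k, {ω | X j ω = f j}) * ENNReal.ofReal (P (f k) (f (k + 1))))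
    {F : (ℕ → ι) → ℝ} (hF : DependsOn F (Set.Icc 1 k)) (g : ι → ℝ) :
    ∫ ω, F (fun n => X n ω) * (g (X (k + 1) ω) - ∑ j, P (X k ω) j * g j) ∂μ = 0 := by
  classical
  let i₀ : ι := Classical.arbitrary ι
  let ext : (Set.Icc 1 k → ι) → ι → ℕ → ι := fun z v n =>
    if h : n ∈ Set.Icc 1 k then z ⟨n, h⟩ else v
  let last : Set.Icc 1 k := ⟨k, hk, le_rfl⟩
  let Y : Ω → (Set.Icc 1 k → ι) × ι := fun ω => (fun j => X j ω, X (k + 1) ω)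
  have hY : Measurable Y := (measurable_pi_lambda _ fun j : Set.Icc 1 k => hX j).prodMk (hX (k + 1))
  let G : (Set.Icc 1 k → ι) × ι → ℝ := fun p =>
    F (ext p.1 i₀) * (g p.2 - ∑ j, P (p.1 last) j * g j)
  have hFG : ∀ ω, F (fun n => X n ω) * (g (X (k + 1) ω) - ∑ j, P (X k ω) j * g j) = G (Y ω) := by
    intro ω
    have : F (fun n => X n ω) = F (ext (Y ω).1 i₀) := hF fun n hn => by simp only [ext, Y, dif_pos hn]
    rw [this]
  have hreal : ∀ z v, (μ.map Y).real {(z, v)} =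
      μ.real (⋂ j ∈ Set.Icc 1 k, {ω | X j ω = ext z i₀ j}) * P (z last) v := by
    intro z v
    have hset : Y ⁻¹' {(z, v)} = ⋂ j ∈ Set.Icc 1 (k + 1), {ω | X j ω = ext z v j} := by
      ext ω
      simp only [Set.mem_preimage, Set.mem_singleton_iff, Y, Prod.mk.injEq, funext_iff,
        Set.mem_iInter, Set.mem_ofPred_eq, Subtype.forall]
      constructor
      · rintro ⟨h1, h2⟩ j hj
        by_cases hjk : j ∈ Set.Icc 1 k
        · simp only [ext, hjk, dite_true]
          exact h1 j hjk
        · have : j = k + 1 := by simp only [Set.mem_Icc] at hj hjk; omega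
          subst this
          simp [ext, h2]
      · intro h
        refine ⟨fun j hj => ?_, ?_⟩
        · have := h j ⟨hj.1, hj.2.trans (Nat.le_succ k)⟩
          simp only [ext, hj, dite_true] at this
          exact this
        · have := h (k + 1) ⟨by omega, le_rfl⟩
          simpa [ext] using this
    have hset' : (⋂ j ∈ Set.Icc 1 k, {ω | X j ω = ext z v j})
        = ⋂ j ∈ Set.Icc 1 k, {ω | X j ω = ext z i₀ j} :=
      Set.iInter₂_congr fun j hj => by simp only [ext, hj, dite_true]
    have hlast : ext z v k = z last := by simp [ext, last, hk]
    have hnext : ext z v (k + 1) = v := by simp [ext]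
    rw [map_measureReal_apply hY (measurableSet_singleton _), hset, measureReal_def, hmarkov,
      hset', hlast, hnext, ENNReal.toReal_mul, ENNReal.toReal_ofReal (hnn _ _), measureReal_def]
  have : IsProbabilityMeasure (μ.map Y) := Measure.isProbabilityMeasure_map hY.aemeasurable
  simp_rw [hFG]
  rw [← integral_map (f := G) hY.aemeasurable
    (measurable_of_finite G).aestronglyMeasurable, integral_fintype Integrable.of_finite,
    Fintype.sum_prod_type]
  refine sum_eq_zero fun z _ => ?_
  simp only [hreal, smul_eq_mul, G]
  have : ∀ v, μ.real (⋂ j ∈ Set.Icc 1 k, {ω | X j ω = ext z i₀ j}) * P (z last) v *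
      (F (ext z i₀) * (g v - ∑ j, P (z last) j * g j)) =
      μ.real (⋂ j ∈ Set.Icc 1 k, {ω | X j ω = ext z i₀ j}) * F (ext z i₀) *
        (P (z last) v * g v - P (z last) v * ∑ j, P (z last) j * g j) := fun v => by ring
  simp only [this, ← mul_sum, sum_sub_distrib, ← sum_mul, hrow, one_mul, sub_self, mul_zero]

/-- A random sequence with bounded increments and linearly growing second moments is almost
surely sublinear. -/
theorem ae_tendsto_div_of_integral_sq_le {Ω : Type*} [MeasurableSpace Ω] {μ : Measure Ω}
    {M : ℕ → Ω → ℝ} {B C : ℝ} (hint : ∀ n, Integrable (fun ω => M n ω ^ 2) μ)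
    (hinc : ∀ n ω, |M (n + 1) ω - M n ω| ≤ B)
    (hsq : ∀ n, ∫ ω, M n ω ^ 2 ∂μ ≤ C * n) :
    ∀ᵐ ω ∂μ, Tendsto (fun n : ℕ => M n ω / n) atTop (𝓝 0) := by
  have hdist : ∀ ω r s, |M (r + s) ω - M r ω| ≤ B * s := by
    intro ω r s
    induction s with
    | zero => simp
    | succ s ih =>
      have := hinc (r + s) ω
      have htri := abs_sub_le (M (r + (s + 1)) ω) (M (r + s) ω) (M r ω)
      rw [← add_assoc] at htri ⊢
      push_cast
      linarith
  have hfin : ∑' n : ℕ, ∫⁻ ω, ENNReal.ofReal ((M (n ^ 2) ω / (n : ℝ) ^ 2) ^ 2) ∂μ ≠ ⊤ := by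
    have hsummable : Summable fun n : ℕ => C * (1 / (n : ℝ) ^ 2) :=
      (Real.summable_one_div_nat_pow.2 one_lt_two).mul_left C
    refine ne_top_of_le_ne_top hsummable.tsum_ofReal_ne_top (ENNReal.tsum_le_tsum fun n => ?_)
    have hi : Integrable (fun ω => (M (n ^ 2) ω / (n : ℝ) ^ 2) ^ 2) μ := by
      simp only [div_pow]
      exact (hint _).div_const _
    rw [← ofReal_integral_eq_lintegral_ofReal hi (ae_of_all _ fun ω => sq_nonneg _)]
    refine ENNReal.ofReal_le_ofReal ?_
    simp only [div_pow]
    rw [integral_div]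
    rcases Nat.eq_zero_or_pos n with rfl | hn
    · simp
    have hn' : (0 : ℝ) < n := by exact_mod_cast hn
    rw [div_le_iff₀ (by positivity)]
    refine (hsq _).trans (le_of_eq ?_)
    push_cast
    field_simp
  rw [← lintegral_tsum fun n => by
    have h := ((hint (n ^ 2)).aestronglyMeasurable.aemeasurable.div_const
      (((n : ℝ) ^ 2) ^ 2)).ennreal_ofReal
    simpa only [div_pow] using h] at hfin
  have hae := ae_lt_top' (AEMeasurable.tsum fun n => by
    have h := ((hint (n ^ 2)).aestronglyMeasurable.aemeasurable.div_const
      (((n : ℝ) ^ 2) ^ 2)).ennreal_ofReal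
    simpa only [div_pow] using h) hfin
  filter_upwards [hae] with ω hω
  have hsub : Tendsto (fun n : ℕ => |M (n ^ 2) ω / (n : ℝ) ^ 2|) atTop (𝓝 0) := by
    have h1 := ENNReal.tendsto_atTop_zero_of_tsum_ne_top hω.ne
    have h2 := (ENNReal.tendsto_toReal ENNReal.zero_ne_top).comp h1
    simp only [Function.comp_def, ENNReal.toReal_ofReal (sq_nonneg _), ENNReal.toReal_zero] at h2
    simpa [Real.sqrt_sq_eq_abs] using h2.sqrt
  have hsqrt : Tendsto Nat.sqrt atTop atTop :=
    tendsto_atTop.2 fun b => (eventually_ge_atTop (b ^ 2)).mono fun n hn =>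
      Nat.le_sqrt'.2 hn
  have hbound : Tendsto (fun s : ℕ => |M (s ^ 2) ω / (s : ℝ) ^ 2| + 2 * B / s) atTop (𝓝 0) := by
    simpa using hsub.add (tendsto_const_div_atTop_nhds_zero_nat (2 * B))
  refine squeeze_zero_norm' ?_ (hbound.comp hsqrt)
  filter_upwards [eventually_gt_atTop 0] with n hn
  have hs : 0 < n.sqrt := Nat.sqrt_pos.2 hn
  obtain ⟨r, hr⟩ := Nat.exists_eq_add_of_le (Nat.sqrt_le' n)
  have hr2 : r ≤ 2 * n.sqrt := by
    have := Nat.sqrt_le_add n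
    nlinarith
  have hB : 0 ≤ B := (abs_nonneg _).trans (hinc 0 ω)
  have hd := hdist ω (n.sqrt ^ 2) r
  rw [← hr] at hd
  have hs' : (0 : ℝ) < n.sqrt := by exact_mod_cast hs
  have hr2' : (r : ℝ) ≤ 2 * n.sqrt := by exact_mod_cast hr2
  have hle : ((n.sqrt : ℝ)) ^ 2 ≤ n := by exact_mod_cast Nat.sqrt_le' n
  have hM : |M n ω| ≤ |M (n.sqrt ^ 2) ω| + B * (2 * n.sqrt) := by
    have h1 := abs_sub_abs_le_abs_sub (M n ω) (M (n.sqrt ^ 2) ω)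
    have h2 := mul_le_mul_of_nonneg_left hr2' hB
    linarith
  simp only [Function.comp, Real.norm_eq_abs, abs_div, Nat.abs_cast, abs_pow]
  calc |M n ω| / n ≤ (|M (n.sqrt ^ 2) ω| + B * (2 * n.sqrt)) / (n.sqrt : ℝ) ^ 2 := by gcongr
    _ = |M (n.sqrt ^ 2) ω| / (n.sqrt : ℝ) ^ 2 + 2 * B / n.sqrt := by field_simp

/-- Strong law of large numbers for additive functionals of a primitive finite Markov chain. -/
theorem ae_tendsto_markov_average {Ω ι : Type*} [MeasurableSpace Ω] {μ : Measure Ω}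
    [IsProbabilityMeasure μ] [Fintype ι] [DecidableEq ι] [Nonempty ι] [MeasurableSpace ι]
    [MeasurableSingletonClass ι] {P : Matrix ι ι ℝ} (hnn : ∀ i j, 0 ≤ P i j)
    (hrow : ∀ i, ∑ j, P i j = 1) (hprim : ∃ k : ℕ, ∀ i j, 0 < (P ^ k) i j)
    {π : ι → ℝ} (hsum : ∑ i, π i = 1) (hstat : ∀ j, ∑ i, π i * P i j = π j)
    {X : ℕ → Ω → ι} (hX : ∀ k, Measurable (X k))
    (hmarkov : ∀ k : ℕ, 1 ≤ k → ∀ f : ℕ → ι, μ (⋂ j ∈ Set.Icc 1 (k + 1), {ω | X j ω = f j})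
      = μ (⋂ j ∈ Set.Icc 1 k, {ω | X j ω = f j}) * ENNReal.ofReal (P (f k) (f (k + 1))))
    (a : ι → ℝ) :
    ∀ᵐ ω ∂μ, Tendsto (fun n : ℕ => (∑ k ∈ Icc 1 n, a (X k ω)) / n) atTop
      (𝓝 (∑ i, π i * a i)) := by
  obtain ⟨k, hk⟩ := hprim
  obtain ⟨g, hg⟩ := exists_poisson_solution hrow hk hsum hstat a
  let d : ι → ι → ℝ := fun x y => g y - ∑ j, P x j * g j
  let M : ℕ → (ℕ → ι) → ℝ := fun n x => ∑ l ∈ range n, d (x (l + 1)) (x (l + 2))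
  obtain ⟨B, hB⟩ : ∃ B, ∀ x y, |d x y| ≤ B := by
    obtain ⟨p, hp⟩ := Finite.exists_max fun p : ι × ι => |d p.1 p.2|
    exact ⟨_, fun x y => hp (x, y)⟩
  have hMsucc : ∀ n x, M (n + 1) x = M n x + d (x (n + 1)) (x (n + 2)) := fun n x =>
    sum_range_succ _ _
  have hdep : ∀ n, DependsOn (M n) (Set.Icc 1 (n + 1)) := by
    intro n x y hxy
    refine sum_congr rfl fun l hl => ?_
    have := mem_range.1 hl
    rw [hxy (l + 1) ⟨by omega, by omega⟩, hxy (l + 2) ⟨by omega, by omega⟩]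
  have hdmeas : ∀ l, Measurable fun ω => d (X (l + 1) ω) (X (l + 2) ω) := fun l =>
    (measurable_of_finite (fun p : ι × ι => d p.1 p.2)).comp ((hX _).prodMk (hX _))
  have hMmeas : ∀ n, Measurable fun ω => M n (fun j => X j ω) := fun n =>
    Finset.measurable_fun_sum _ fun l _ => hdmeas l
  have hMbound : ∀ n x, |M n x| ≤ n * B := fun n x => by
    simpa using (abs_sum_le_sum_abs _ _).trans
      (sum_le_card_nsmul (range n) _ B fun l _ => hB (x (l + 1)) (x (l + 2)))
  have hMsq : ∀ n, Integrable (fun ω => M n (fun j => X j ω) ^ 2) μ := fun n =>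
    Integrable.of_bound ((hMmeas n).pow_const 2).aestronglyMeasurable ((n * B) ^ 2)
      (ae_of_all _ fun ω => by
        rw [norm_pow, Real.norm_eq_abs]
        exact pow_le_pow_left₀ (abs_nonneg _) (hMbound n fun j => X j ω) 2)
  have hdsq : ∀ n, Integrable (fun ω => d (X (n + 1) ω) (X (n + 2) ω) ^ 2) μ := fun n =>
    Integrable.of_bound ((hdmeas n).pow_const 2).aestronglyMeasurable (B ^ 2)
      (ae_of_all _ fun ω => by
        rw [norm_pow, Real.norm_eq_abs]
        exact pow_le_pow_left₀ (abs_nonneg _) (hB _ _) 2)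
  have hMd : ∀ n, Integrable (fun ω => M n (fun j => X j ω) * d (X (n + 1) ω) (X (n + 2) ω)) μ :=
    fun n => Integrable.of_bound ((hMmeas n).mul (hdmeas n)).aestronglyMeasurable (n * B * B)
      (ae_of_all _ fun ω => by
        rw [norm_mul, Real.norm_eq_abs, Real.norm_eq_abs]
        exact mul_le_mul (hMbound n fun j => X j ω) (hB _ _) (abs_nonneg _)
          ((abs_nonneg _).trans (hMbound n fun j => X j ω)))
  have hmoment : ∀ n : ℕ, ∫ ω, M n (fun j => X j ω) ^ 2 ∂μ ≤ B ^ 2 * n := by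
    intro n
    induction n with
    | zero => simp [M]
    | succ n ih =>
      have horth : ∫ ω, M n (fun j => X j ω) * d (X (n + 1) ω) (X (n + 2) ω) ∂μ = 0 :=
        integral_path_mul_next hnn hrow hX (Nat.le_add_left 1 n)
          (hmarkov (n + 1) (Nat.le_add_left 1 n)) (hdep n) g
      have hexp : ∀ ω, M (n + 1) (fun j => X j ω) ^ 2 = M n (fun j => X j ω) ^ 2
          + 2 * (M n (fun j => X j ω) * d (X (n + 1) ω) (X (n + 2) ω))
          + d (X (n + 1) ω) (X (n + 2) ω) ^ 2 := fun ω => by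
        rw [hMsucc n fun j => X j ω]
        ring
      have hlast : ∫ ω, d (X (n + 1) ω) (X (n + 2) ω) ^ 2 ∂μ ≤ B ^ 2 := by
        refine (integral_mono (hdsq n) (integrable_const (B ^ 2)) fun ω => ?_).trans_eq (by simp)
        exact sq_le_sq' (abs_le.1 (hB _ _)).1 (abs_le.1 (hB _ _)).2
      simp only [hexp]
      have hadd := integral_add ((hMsq n).add ((hMd n).const_mul 2)) (hdsq n)
      simp only [Pi.add_apply] at hadd
      rw [hadd, integral_add (hMsq n) ((hMd n).const_mul 2), integral_const_mul, horth]
      push_cast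
      linarith
  have hlim := ae_tendsto_div_of_integral_sq_le (μ := μ) (B := B) (C := B ^ 2) hMsq
    (fun n ω => by rw [hMsucc n fun j => X j ω, add_sub_cancel_left]; exact hB _ _) hmoment
  filter_upwards [hlim] with ω hω
  have htel : ∀ n : ℕ, ∑ l ∈ Icc 1 n, a (X l ω) =
      n * (∑ i, π i * a i) + (g (X 1 ω) - g (X (n + 1) ω)) + M n (fun j => X j ω) := by
    intro n
    induction n with
    | zero => simp [M]
    | succ n ih =>
      rw [sum_Icc_succ_top (by omega), ih, hMsucc n fun j => X j ω]
      have := hg (X (n + 1) ω)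
      simp only [d]
      push_cast
      linarith
  obtain ⟨K, hK⟩ : ∃ K, ∀ x, |g x| ≤ K := by
    obtain ⟨p, hp⟩ := Finite.exists_max fun p : ι => |g p|
    exact ⟨_, hp⟩
  have hbdry : Tendsto (fun n : ℕ => (g (X 1 ω) - g (X (n + 1) ω)) / n) atTop (𝓝 0) := by
    refine squeeze_zero_norm (fun n => ?_) (tendsto_const_div_atTop_nhds_zero_nat (K + K))
    rw [norm_div, Real.norm_eq_abs, Real.norm_natCast]
    gcongr
    exact (abs_sub _ _).trans (add_le_add (hK _) (hK _))
  have hmain := (hbdry.add hω).const_add (∑ i, π i * a i)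
  rw [add_zero, add_zero] at hmain
  refine hmain.congr' ?_
  filter_upwards [eventually_gt_atTop 0] with n hn
  have hn' : (n : ℝ) ≠ 0 := by exact_mod_cast hn.ne'
  rw [htel]
  field_simp
  ring

/-- Law of Large Numbers for the general compound Hawkes process with n-state
dependent orders (Lemmas "LLN for NLCHPnSDO" and "LLN for GCHPnSDO"):
for every `t ≥ 0`, `S_{nt}/n → a* c t` almost surely as `n → ∞`. -/
theorem LLN_GCHPnSDO
    {Ω : Type*} [MeasurableSpace Ω] (Pr : Measure Ω) [IsProbabilityMeasure Pr]
    (m : ℕ) (hm : 1 ≤ m)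
    (P : Matrix (Fin m) (Fin m) ℝ)
    (hPnn : ∀ i j, 0 ≤ P i j)
    (hProw : ∀ i, ∑ j, P i j = 1)
    (hPprim : ∃ k : ℕ, ∀ i j, 0 < (P ^ k) i j)
    (π : Fin m → ℝ)
    (hπpos : ∀ i, 0 < π i) (hπsum : ∑ i, π i = 1)
    (hπstat : ∀ j, ∑ i, π i * P i j = π j)
    (X : ℕ → Ω → Fin m)
    (hXmeas : ∀ k, Measurable (X k))
    (hXmarkov : ∀ k : ℕ, 1 ≤ k → ∀ f : ℕ → Fin m,
      Pr (⋂ j ∈ Set.Icc 1 (k + 1), {ω | X j ω = f j})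
        = Pr (⋂ j ∈ Set.Icc 1 k, {ω | X j ω = f j}) * ENNReal.ofReal (P (f k) (f (k + 1))))
    (a : Fin m → ℝ)
    (astar : ℝ) (hastar : astar = ∑ i, π i * a i)
    (N : ℝ → Ω → ℕ)
    (hNmeas : ∀ t, Measurable (N t))
    (hN0 : ∀ ω, N 0 ω = 0)
    (hNmono : ∀ ω, Monotone (fun t => N t ω))
    (hNrc : ∀ ω t, ContinuousWithinAt (fun s => (N s ω : ℝ)) (Set.Ici t) t)
    (c : ℝ) (hc : 0 < c)
    (hNLLN : ∀ᵐ ω ∂Pr, Tendsto (fun t : ℝ => (N t ω : ℝ) / t) atTop (𝓝 c))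
    (hindep : IndepFun (fun ω (t : ℝ) => N t ω) (fun ω (k : ℕ) => X k ω) Pr)
    (S0 : ℝ) (S : ℝ → Ω → ℝ)
    (hS : ∀ t ω, S t ω = S0 + ∑ k ∈ Finset.Icc 1 (N t ω), a (X k ω))
    (t : ℝ) (ht : 0 ≤ t) :
    ∀ᵐ ω ∂Pr, Tendsto (fun n : ℕ => S (n * t) ω / n) atTop (𝓝 (astar * c * t)) := by
  have : Nonempty (Fin m) := ⟨⟨0, hm⟩⟩
  rcases ht.eq_or_lt with rfl | ht
  · refine ae_of_all _ fun ω => ?_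
    simpa [hS, hN0] using tendsto_const_div_atTop_nhds_zero_nat S0
  have hlln := ae_tendsto_markov_average hPnn hProw hPprim hπsum hπstat hXmeas hXmarkov a
  rw [← hastar] at hlln
  filter_upwards [hNLLN, hlln] with ω hN hA
  have htime : Tendsto (fun n : ℕ => (n : ℝ) * t) atTop atTop :=
    tendsto_natCast_atTop_atTop.atTop_mul_const ht
  have hrate : Tendsto (fun n : ℕ => (N (n * t) ω : ℝ) / n) atTop (𝓝 (c * t)) := by
    refine ((hN.comp htime).mul_const t).congr fun n => ?_
    simp only [Function.comp]
    field_simp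
  have hcount : Tendsto (fun n : ℕ => N (n * t) ω) atTop atTop := by
    rw [← tendsto_natCast_atTop_iff (R := ℝ)]
    refine (hrate.pos_mul_atTop (mul_pos hc ht) tendsto_natCast_atTop_atTop).congr' ?_
    filter_upwards [eventually_gt_atTop 0] with n hn
    have hn' : (n : ℝ) ≠ 0 := by exact_mod_cast hn.ne'
    field_simp
  have hmain := (tendsto_const_div_atTop_nhds_zero_nat S0).add ((hA.comp hcount).mul hrate)
  rw [zero_add, ← mul_assoc] at hmain
  refine hmain.congr' ?_
  filter_upwards [hcount.eventually_gt_atTop 0] with n hn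
  have hn' : (N (n * t) ω : ℝ) ≠ 0 := by exact_mod_cast hn.ne'
  simp only [Function.comp, hS]
  field_simp
end

section
/- One-dimensional central limit theorem for additive functionals of a finite ergodic Markov chain: the normalized centered sums n^{−1/2} ∑_{k=1}^n (a(X_k) − a*) converge in distribution, as n → ∞, to a centered Gaussian random variable with variance (σ*)². -/
open MeasureTheory ProbabilityTheory Filter Finset Matrix Topology

section PoissonEquation

lemma of_const_mulVec {E : Type*} [Fintype E] (π x : E → ℝ) :
    Matrix.of (fun _ : E => π) *ᵥ x = fun _ => π ⬝ᵥ x := rfl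

variable {E : Type*} [Fintype E] [DecidableEq E] {P : Matrix E E ℝ} {π : E → ℝ}

/-- Maximum principle: the harmonic functions of a primitive stochastic matrix are constant. -/
lemma eq_of_mulVec_eq_self_of_primitive_s3 (hP : P ∈ rowStochastic ℝ E)
    (hprim : ∃ k : ℕ, ∀ i j, 0 < (P ^ k) i j) {x : E → ℝ} (hx : P *ᵥ x = x) (i j : E) :
    x i = x j := by
  obtain ⟨k, hk⟩ := hprim
  have hPk : P ^ k ∈ rowStochastic ℝ E := pow_mem hP k
  have hxk : P ^ k *ᵥ x = x := by
    clear hk hPk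
    induction k with
    | zero => simp
    | succ k ih => rw [pow_succ, ← mulVec_mulVec, hx, ih]
  have : Nonempty E := ⟨i⟩
  obtain ⟨i₀, hi₀⟩ := Finite.exists_max x
  have hsum : ∑ l, (P ^ k) i₀ l * (x i₀ - x l) = 0 := by
    have h := congrFun hxk i₀
    simp only [mulVec, dotProduct] at h
    simp only [mul_sub, sum_sub_distrib, ← sum_mul, sum_row_of_mem_rowStochastic hPk, h]
    ring
  have hzero := (sum_eq_zero_iff_of_nonneg fun l _ =>
    mul_nonneg (hk i₀ l).le (sub_nonneg.2 (hi₀ l))).1 hsum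
  have hmax (l : E) : x l = x i₀ := by
    rcases mul_eq_zero.1 (hzero l (mem_univ l)) with h | h
    · exact absurd h (hk i₀ l).ne'
    · linarith
  rw [hmax i, hmax j]

lemma dotProduct_add_of_const_sub_one_mulVec (hsum : ∑ i, π i = 1) (hstat : π ᵥ* P = π)
    (x : E → ℝ) : π ⬝ᵥ ((P + Matrix.of (fun _ => π) - 1) *ᵥ x) = π ⬝ᵥ x := by
  have hconst : π ⬝ᵥ (fun _ : E => π ⬝ᵥ x) = π ⬝ᵥ x := by
    simp only [dotProduct, ← sum_mul, hsum, one_mul]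
  rw [sub_mulVec, add_mulVec, one_mulVec, of_const_mulVec, dotProduct_sub, dotProduct_add,
    dotProduct_mulVec, hstat, hconst]
  ring

lemma isUnit_add_of_const_sub_one (hP : P ∈ rowStochastic ℝ E)
    (hprim : ∃ k : ℕ, ∀ i j, 0 < (P ^ k) i j) (hsum : ∑ i, π i = 1) (hstat : π ᵥ* P = π) :
    IsUnit (P + Matrix.of (fun _ => π) - 1) := by
  rw [← mulVec_injective_iff_isUnit, ← Matrix.coe_mulVecLin, ← LinearMap.ker_eq_bot,
    LinearMap.ker_eq_bot']
  intro x hx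
  rw [mulVecLin_apply] at hx
  have hπx : π ⬝ᵥ x = 0 := by
    rw [← dotProduct_add_of_const_sub_one_mulVec hsum hstat, hx, dotProduct_zero]
  have hPx : P *ᵥ x = x := by
    rw [sub_mulVec, add_mulVec, one_mulVec, of_const_mulVec, hπx] at hx
    simpa [sub_eq_zero, ← Pi.zero_def] using hx
  ext i
  have hxi : π ⬝ᵥ x = x i := by
    simp only [dotProduct, fun j => eq_of_mulVec_eq_self_of_primitive_s3 hP hprim hPx j i,
      ← sum_mul, hsum, one_mul]
  simpa [hxi] using hπx

/-- The fundamental matrix solves the Poisson equation. -/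
lemma mulVec_inv_mulVec_eq_add (hP : P ∈ rowStochastic ℝ E)
    (hprim : ∃ k : ℕ, ∀ i j, 0 < (P ^ k) i j) (hsum : ∑ i, π i = 1) (hstat : π ᵥ* P = π)
    {c : E → ℝ} (hc : π ⬝ᵥ c = 0) :
    P *ᵥ ((P + Matrix.of (fun _ => π) - 1)⁻¹ *ᵥ c) =
      (P + Matrix.of (fun _ => π) - 1)⁻¹ *ᵥ c + c := by
  set x := (P + Matrix.of (fun _ => π) - 1)⁻¹ *ᵥ c with hx
  have hNx : (P + Matrix.of (fun _ => π) - 1) *ᵥ x = c := by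
    rw [hx, mulVec_mulVec, mul_nonsing_inv _
      ((isUnit_iff_isUnit_det _).1 (isUnit_add_of_const_sub_one hP hprim hsum hstat)), one_mulVec]
  have hπx : π ⬝ᵥ x = 0 := by
    rw [← dotProduct_add_of_const_sub_one_mulVec hsum hstat, hNx, hc]
  rw [sub_mulVec, add_mulVec, one_mulVec, of_const_mulVec, hπx, ← Pi.zero_def, add_zero] at hNx
  rw [← hNx]
  abel

end PoissonEquation

section MarkovProperty

variable {Ω E : Type*} [MeasurableSpace Ω] {μ : Measure Ω} [IsFiniteMeasure μ]
  [Fintype E] [MeasurableSpace E] [MeasurableSingletonClass E]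

lemma integral_comp_eq_sum_measureReal {Y : Ω → E} (hY : Measurable Y) (F : E → ℂ) :
    ∫ ω, F (Y ω) ∂μ = ∑ y, μ.real (Y ⁻¹' {y}) * F y := by
  rw [← integral_map (f := F) hY.aemeasurable (measurable_of_finite F).aestronglyMeasurable,
    integral_fintype .of_finite]
  refine sum_congr rfl fun y _ => ?_
  rw [map_measureReal_apply hY (measurableSet_singleton y), Complex.real_smul]

variable {P : Matrix E E ℝ} {X : ℕ → Ω → E}

/-- The Markov property tested against functions of the past and of the next state. -/
lemma integral_past_mul_next
    (hP : ∀ i j, 0 ≤ P i j) (hX : ∀ k, Measurable (X k))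
    (hmarkov : ∀ k : ℕ, 1 ≤ k → ∀ f : ℕ → E,
      μ (⋂ j ∈ Set.Icc 1 (k + 1), {ω | X j ω = f j})
        = μ (⋂ j ∈ Set.Icc 1 k, {ω | X j ω = f j}) * ENNReal.ofReal (P (f k) (f (k + 1))))
    (k : ℕ) (H : (Fin (k + 1) → E) → ℂ) (h : E → ℂ) :
    ∫ ω, H (fun i => X (i + 1) ω) * h (X (k + 2) ω) ∂μ =
      ∫ ω, H (fun i => X (i + 1) ω) * ∑ j, (P (X (k + 1) ω) j : ℂ) * h j ∂μ := by
  have hcyl (n : ℕ) (f : ℕ → E) : (fun ω (i : Fin n) => X (i + 1) ω) ⁻¹'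
      {fun i : Fin n => f (i + 1)} =
      ⋂ j ∈ Set.Icc 1 n, {ω | X j ω = f j} := by
    ext ω
    simp only [Set.mem_preimage, Set.mem_singleton_iff, funext_iff, Set.mem_iInter, Set.mem_Icc,
      Set.mem_ofPred_eq]
    refine ⟨fun hf j hj => ?_, fun hf i => hf (i + 1) ⟨by omega, i.2⟩⟩
    have := hf ⟨j - 1, by omega⟩
    simpa only [Nat.sub_add_cancel hj.1] using this
  have hstep (j : E) (y : Fin (k + 1) → E) :
      μ.real ((fun ω (i : Fin (k + 2)) => X (i + 1) ω) ⁻¹' {Fin.snoc (α := fun _ => E) y j}) =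
        μ.real ((fun ω (i : Fin (k + 1)) => X (i + 1) ω) ⁻¹' {y}) * P (y (Fin.last k)) j := by
    let f : ℕ → E := fun n => Fin.snoc (α := fun _ => E) y j (Fin.ofNat (k + 2) (n - 1))
    have hf₂ : Fin.snoc (α := fun _ => E) y j = fun i : Fin (k + 2) => f (i + 1) := by
      ext i
      simp [f]
    have hf₁ : y = fun i : Fin (k + 1) => f (i + 1) := by
      ext i
      have : Fin.ofNat (k + 2) (i : ℕ) = i.castSucc := by
        ext
        simp
      simp only [f, Nat.add_sub_cancel, this, Fin.snoc_castSucc]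
    have hlast : y (Fin.last k) = f (k + 1) := by
      conv_lhs => rw [hf₁]
      rfl
    have hj : j = f (k + 2) := by
      simpa using congrFun hf₂ (Fin.last (k + 1))
    rw [hf₂, hcyl, hlast]
    conv_rhs => rw [hf₁, hcyl]
    rw [measureReal_def, hmarkov (k + 1) (by omega), ENNReal.toReal_mul,
      ENNReal.toReal_ofReal (hP _ _), ← measureReal_def, hj]
  have hY (n : ℕ) : Measurable fun ω (i : Fin n) => X (i + 1) ω :=
    measurable_pi_lambda _ fun i => hX _
  have hl := integral_comp_eq_sum_measureReal (μ := μ) (hY (k + 2))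
    fun y => H (fun i => y i.castSucc) * h (y (Fin.last (k + 1)))
  have hr := integral_comp_eq_sum_measureReal (μ := μ) (hY (k + 1))
    fun y => H y * ∑ j, (P (y (Fin.last k)) j : ℂ) * h j
  simp only [Fin.val_last, Fin.val_castSucc] at hl hr
  rw [show k + 2 = k + 1 + 1 from rfl, hl, hr,
    ← (Fin.snocEquiv fun _ : Fin (k + 2) => E).sum_comp, Fintype.sum_prod_type_right]
  refine sum_congr rfl fun y _ => ?_
  rw [mul_sum, mul_sum]
  refine sum_congr rfl fun j _ => ?_
  have := hstep j y
  simp only [Fin.snocEquiv, Equiv.coe_fn_mk, Fin.snoc_castSucc, Fin.snoc_last]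
  rw [this]
  push_cast
  ring

end MarkovProperty

section TwistedOperator

open Asymptotics

/-- Third-order expansion of the characteristic-function operator on a perturbed eigenfunction. -/
lemma exp_mul_sub_exp_mul_isBigO {b q g r ρ s : ℝ} (hq : q = g + b)
    (hρ : ρ = r + (b ^ 2 / 2 - b * q - s / 2)) :
    (fun u : ℝ => Complex.exp (u * b * Complex.I) * (1 - u * q * Complex.I + u ^ 2 * ρ) -
      Complex.exp (-(u ^ 2 * s / 2)) * (1 - u * g * Complex.I + u ^ 2 * r))
      =O[𝓝 0] fun u : ℝ => (u : ℂ) ^ 3 := by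
  have bdd (f : ℝ → ℂ) (hf : Continuous f) : f =O[𝓝 0] fun _ => (1 : ℂ) :=
    hf.continuousAt.isBigO_one ℂ
  have cube_mul (f : ℝ → ℂ) (hf : Continuous f) :
      (fun u : ℝ => (u : ℂ) ^ 3 * f u) =O[𝓝 0] fun u : ℝ => (u : ℂ) ^ 3 :=
    ((isBigO_refl _ _).mul (bdd f hf)).congr_right fun u => mul_one _
  have h1 : (fun u : ℝ => Complex.exp (u * b * Complex.I) -
      (1 + u * b * Complex.I - u ^ 2 * b ^ 2 / 2)) =O[𝓝 0] fun u : ℝ => (u : ℂ) ^ 3 := by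
    have ht : Tendsto (fun u : ℝ => (u * b * Complex.I : ℂ)) (𝓝 0) (𝓝 0) :=
      Continuous.tendsto' (by fun_prop) _ _ (by simp)
    refine (((Complex.exp_sub_sum_range_isBigO_pow 3).comp_tendsto ht).congr
      (fun u => ?_) fun u => ?_).trans (cube_mul (fun _ => (b * Complex.I) ^ 3) (by fun_prop))
    · simp only [Function.comp, sum_range_succ, range_zero, sum_empty, Nat.factorial]
      push_cast
      linear_combination (-(u : ℂ) ^ 2 * b ^ 2 / 2) * Complex.I_sq
    · simp only [Function.comp]
      ring
  have h2 : (fun u : ℝ => Complex.exp (-(u ^ 2 * s / 2)) - (1 - u ^ 2 * s / 2))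
      =O[𝓝 0] fun u : ℝ => (u : ℂ) ^ 3 := by
    have ht : Tendsto (fun u : ℝ => (-(u ^ 2 * s / 2) : ℂ)) (𝓝 0) (𝓝 0) :=
      Continuous.tendsto' (by fun_prop) _ _ (by simp)
    refine (((Complex.exp_sub_sum_range_isBigO_pow 2).comp_tendsto ht).congr
      (fun u => ?_) fun u => ?_).trans (cube_mul (fun u => u * (s / 2) ^ 2) (by fun_prop))
    · simp only [Function.comp, sum_range_succ, range_zero, sum_empty, Nat.factorial]
      push_cast
      ring
    · simp only [Function.comp]
      ring
  have h3 := ((h1.mul (bdd (fun u : ℝ => 1 - u * q * Complex.I + u ^ 2 * ρ) (by fun_prop))).sub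
    (h2.mul (bdd (fun u : ℝ => 1 - u * g * Complex.I + u ^ 2 * r) (by fun_prop)))).congr_right
    (fun u => mul_one _)
  refine (h3.add (cube_mul (fun u : ℝ => (b ^ 2 * q / 2 + b * ρ - g * s / 2) * Complex.I +
    u * (s * r / 2 - b ^ 2 * ρ / 2)) (by fun_prop))).congr_left fun u => ?_
  subst hρ hq
  push_cast
  linear_combination (u ^ 2 * b * (g + b) : ℂ) * Complex.I_sq

end TwistedOperator

lemma norm_sub_pow_mul_le {A : ℕ → ℂ} {l : ℂ} {ε : ℝ} (hl : ‖l‖ ≤ 1)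
    (hA : ∀ k, ‖A (k + 1) - l * A k‖ ≤ ε) (n : ℕ) : ‖A n - l ^ n * A 0‖ ≤ n * ε := by
  induction n with
  | zero => simp
  | succ n ih =>
    calc ‖A (n + 1) - l ^ (n + 1) * A 0‖
        = ‖(A (n + 1) - l * A n) + l * (A n - l ^ n * A 0)‖ := by congr 1; ring
      _ ≤ ‖A (n + 1) - l * A n‖ + ‖l‖ * ‖A n - l ^ n * A 0‖ := by
        rw [← norm_mul]; exact norm_add_le _ _
      _ ≤ ε + 1 * (n * ε) := by gcongr; exact hA n
      _ = (n + 1 : ℕ) * ε := by push_cast; ring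

section CharacteristicFunction

variable {Ω E : Type*} [MeasurableSpace Ω] {μ : Measure Ω} [IsProbabilityMeasure μ]
  [Fintype E] [MeasurableSpace E] [MeasurableSingletonClass E]
  {P : Matrix E E ℝ} {X : ℕ → Ω → E}

lemma norm_exp_ofReal_mul_I_mul_le (x : ℝ) (z : ℂ) : ‖Complex.exp (x * Complex.I) * z‖ ≤ ‖z‖ := by
  rw [norm_mul, Complex.norm_exp_ofReal_mul_I, one_mul]

/-- If `h` is an approximate eigenfunction for the eigenvalue `l` of the twisted transition
operator, then the characteristic function of the additive functional is close to `l ^ n`. -/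
lemma norm_integral_exp_sub_pow_le
    (hP : ∀ i j, 0 ≤ P i j) (hX : ∀ k, Measurable (X k))
    (hmarkov : ∀ k : ℕ, 1 ≤ k → ∀ f : ℕ → E,
      μ (⋂ j ∈ Set.Icc 1 (k + 1), {ω | X j ω = f j})
        = μ (⋂ j ∈ Set.Icc 1 k, {ω | X j ω = f j}) * ENNReal.ofReal (P (f k) (f (k + 1))))
    (b : E → ℝ) (u : ℝ) (h : E → ℂ) {l : ℂ} (hl : ‖l‖ ≤ 1) {δ ε : ℝ}
    (hδ : ∀ i, ‖h i - 1‖ ≤ δ)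
    (hε : ∀ i, ‖Complex.exp (u * b i * Complex.I) * ∑ j, (P i j : ℂ) * h j - l * h i‖ ≤ ε)
    (n : ℕ) :
    ‖∫ ω, Complex.exp ((u * ∑ k ∈ Icc 1 n, b (X k ω) : ℝ) * Complex.I) ∂μ - l ^ n‖ ≤
      2 * δ + n * ε := by
  have hmeas {f : E → ℂ} (k : ℕ) : Measurable fun ω => f (X k ω) :=
    (measurable_of_finite f).comp (hX k)
  have hSmeas (n : ℕ) :
      Measurable fun ω => Complex.exp ((u * ∑ k ∈ Icc 1 n, b (X k ω) : ℝ) * Complex.I) := by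
    have (k : ℕ) : Measurable fun ω => b (X k ω) := (measurable_of_finite b).comp (hX k)
    fun_prop
  have hint (n k : ℕ) (f : E → ℂ) : Integrable (fun ω =>
      Complex.exp ((u * ∑ k ∈ Icc 1 n, b (X k ω) : ℝ) * Complex.I) * f (X k ω)) μ := by
    refine .of_bound ((hSmeas n).mul (hmeas k)).aestronglyMeasurable (∑ i, ‖f i‖)
      (.of_forall fun ω => (norm_exp_ofReal_mul_I_mul_le _ _).trans ?_)
    exact single_le_sum (f := fun i => ‖f i‖) (fun _ _ => norm_nonneg _) (mem_univ _)
  let A (k : ℕ) : ℂ :=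
    ∫ ω, Complex.exp ((u * ∑ k ∈ Icc 1 k, b (X k ω) : ℝ) * Complex.I) * h (X (k + 1) ω) ∂μ
  have hnear (n : ℕ) :
      ‖∫ ω, Complex.exp ((u * ∑ k ∈ Icc 1 n, b (X k ω) : ℝ) * Complex.I) ∂μ - A n‖ ≤ δ := by
    have hi := hint n 1 fun _ => 1
    simp only [mul_one] at hi
    rw [← integral_sub hi (hint n (n + 1) h)]
    refine (norm_integral_le_of_norm_le_const (C := δ) (.of_forall fun ω => ?_)).trans (by simp)
    rw [← mul_one_sub]
    refine (norm_exp_ofReal_mul_I_mul_le _ _).trans ?_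
    rw [norm_sub_rev]
    exact hδ _
  have hA (k : ℕ) : ‖A (k + 1) - l * A k‖ ≤ ε := by
    have hsum (ω : Ω) : ∑ i : Fin (k + 1), b (X (i + 1) ω) = ∑ i ∈ Icc 1 (k + 1), b (X i ω) := by
      rw [Fin.sum_univ_eq_sum_range fun i => b (X (i + 1) ω), range_eq_Ico,
        sum_Ico_add' (fun i => b (X i ω)) 0 (k + 1) 1]
      rfl
    have hnext := integral_past_mul_next hP hX hmarkov k
      (fun y => Complex.exp ((u * ∑ i, b (y i) : ℝ) * Complex.I)) h
    simp only [hsum] at hnext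
    have hAk : A (k + 1) = ∫ ω, Complex.exp ((u * ∑ k ∈ Icc 1 k, b (X k ω) : ℝ) * Complex.I) *
        (Complex.exp (u * b (X (k + 1) ω) * Complex.I) *
          ∑ j, (P (X (k + 1) ω) j : ℂ) * h j) ∂μ := by
      refine hnext.trans (integral_congr_ae (.of_forall fun ω => ?_))
      simp only
      rw [sum_Icc_succ_top (by omega), ← mul_assoc, ← Complex.exp_add]
      congr 2
      push_cast
      ring
    rw [hAk, ← integral_const_mul, ← integral_sub
      (hint k (k + 1) fun i => Complex.exp (u * b i * Complex.I) * ∑ j, (P i j : ℂ) * h j)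
      ((hint k (k + 1) h).const_mul l)]
    refine (norm_integral_le_of_norm_le_const (C := ε) (.of_forall fun ω => ?_)).trans (by simp)
    rw [mul_left_comm l, ← mul_sub]
    exact (norm_exp_ofReal_mul_I_mul_le _ _).trans (hε _)
  have h0 : ‖A 0 - 1‖ ≤ δ := by
    have := hnear 0
    rw [norm_sub_rev] at this
    simpa using this
  have hpow : ‖l ^ n * (A 0 - 1)‖ ≤ δ := by
    rw [norm_mul, norm_pow]
    exact (mul_le_of_le_one_left (norm_nonneg _) (pow_le_one₀ (norm_nonneg _) hl)).trans h0
  set φ := ∫ ω, Complex.exp ((u * ∑ k ∈ Icc 1 n, b (X k ω) : ℝ) * Complex.I) ∂μ with hφ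
  calc ‖φ - l ^ n‖ = ‖(φ - A n) + (A n - l ^ n * A 0) + l ^ n * (A 0 - 1)‖ := by congr 1; ring
    _ ≤ ‖φ - A n‖ + ‖A n - l ^ n * A 0‖ + ‖l ^ n * (A 0 - 1)‖ := norm_add₃_le
    _ ≤ δ + n * ε + δ := by
      gcongr
      · exact hnear n
      · exact norm_sub_pow_mul_le hl hA n
    _ = 2 * δ + n * ε := by ring

/-- Convergence of the characteristic functions, given solutions of two Poisson equations. -/
lemma tendsto_integral_exp_additive_functional
    (hP : ∀ i j, 0 ≤ P i j) (hrow : ∀ i, ∑ j, P i j = 1) (hX : ∀ k, Measurable (X k))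
    (hmarkov : ∀ k : ℕ, 1 ≤ k → ∀ f : ℕ → E,
      μ (⋂ j ∈ Set.Icc 1 (k + 1), {ω | X j ω = f j})
        = μ (⋂ j ∈ Set.Icc 1 k, {ω | X j ω = f j}) * ENNReal.ofReal (P (f k) (f (k + 1))))
    {b g r : E → ℝ} {s : ℝ} (hs : 0 ≤ s) (hg : P *ᵥ g = g + b)
    (hr : ∀ i, (P *ᵥ r) i = r i + (b i ^ 2 / 2 - b i * (P *ᵥ g) i - s / 2)) (t : ℝ) :
    Tendsto (fun n : ℕ =>
      ∫ ω, Complex.exp ((t / √n * ∑ k ∈ Icc 1 n, b (X k ω) : ℝ) * Complex.I) ∂μ)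
      atTop (𝓝 (Complex.exp (-(t ^ 2 * s / 2)))) := by
  let h (u : ℝ) (i : E) : ℂ := 1 - u * g i * Complex.I + u ^ 2 * r i
  let l (u : ℝ) : ℂ := Complex.exp (-(u ^ 2 * s / 2))
  let err (u : ℝ) (i : E) : ℂ :=
    Complex.exp (u * b i * Complex.I) * ∑ j, (P i j : ℂ) * h u j - l u * h u i
  have hPh (u : ℝ) (i : E) : ∑ j, (P i j : ℂ) * h u j =
      1 - u * (P *ᵥ g) i * Complex.I + u ^ 2 * (P *ᵥ r) i := by
    have hone : (1 : ℂ) = ∑ j, (P i j : ℂ) := by exact_mod_cast (hrow i).symm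
    simp only [mulVec, dotProduct, h]
    rw [hone]
    push_cast
    simp only [mul_sum, sum_mul, ← sum_sub_distrib, ← sum_add_distrib]
    rw [← hone]
    exact sum_congr rfl fun j _ => by ring
  have herr (i : E) : (fun u => err u i) =O[𝓝 0] fun u : ℝ => (u : ℂ) ^ 3 := by
    simp only [err, hPh]
    exact exp_mul_sub_exp_mul_isBigO (congrFun hg i) (hr i)
  have hu : Tendsto (fun n : ℕ => t / √n) atTop (𝓝 0) :=
    (Real.tendsto_sqrt_atTop.comp tendsto_natCast_atTop_atTop).const_div_atTop t
  have hδ : Tendsto (fun n : ℕ => ∑ i, ‖h (t / √n) i - 1‖) atTop (𝓝 0) := by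
    have : Tendsto (fun u : ℝ => ∑ i, ‖h u i - 1‖) (𝓝 0) (𝓝 0) :=
      Continuous.tendsto' (by fun_prop) _ _ (by simp [h])
    exact this.comp hu
  have hε : Tendsto (fun n : ℕ => n * ∑ i, ‖err (t / √n) i‖) atTop (𝓝 0) := by
    simp only [mul_sum]
    rw [← sum_const_zero (s := (univ : Finset E))]
    refine tendsto_finsetSum _ fun i _ => ?_
    have hO := ((Asymptotics.isBigO_refl (fun n : ℕ => (n : ℝ)) atTop).mul
      ((herr i).norm_left.norm_right.comp_tendsto hu))
    refine hO.trans_tendsto ?_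
    have : Tendsto (fun n : ℕ => t ^ 2 * |t / √n|) atTop (𝓝 0) := by
      simpa using hu.abs.const_mul (t ^ 2)
    refine this.congr' ?_
    filter_upwards [eventually_gt_atTop 0] with n hn
    have hn' : (0 : ℝ) < n := by exact_mod_cast hn
    have hsq : (t / √n) ^ 2 = t ^ 2 / n := by rw [div_pow, Real.sq_sqrt hn'.le]
    simp only [Function.comp, norm_pow, Complex.norm_real, Real.norm_eq_abs]
    rw [pow_succ |t / √n|, sq_abs, hsq]
    field_simp
  have hpow : ∀ᶠ n : ℕ in atTop, l (t / √n) ^ n = Complex.exp (-(t ^ 2 * s / 2)) := by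
    filter_upwards [eventually_gt_atTop 0] with n hn
    have hn' : (n : ℂ) ≠ 0 := by exact_mod_cast hn.ne'
    have hsq : ((√n : ℝ) : ℂ) ^ 2 = n := by
      exact_mod_cast Real.sq_sqrt (Nat.cast_nonneg (α := ℝ) n)
    simp only [l]
    rw [← Complex.exp_nat_mul]
    congr 1
    push_cast
    rw [div_pow, hsq]
    field_simp
  have hl (u : ℝ) : ‖l u‖ ≤ 1 := by
    have : (-(u ^ 2 * s / 2) : ℂ) = ((-(u ^ 2 * s / 2) : ℝ) : ℂ) := by push_cast; rfl
    simp only [l]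
    rw [this, Complex.norm_exp_ofReal]
    exact Real.exp_le_one_iff.2 (neg_nonpos.2 (by positivity))
  rw [tendsto_iff_norm_sub_tendsto_zero]
  have hbound : Tendsto (fun n : ℕ =>
      2 * ∑ i, ‖h (t / √n) i - 1‖ + n * ∑ i, ‖err (t / √n) i‖) atTop (𝓝 0) := by
    simpa using (hδ.const_mul 2).add hε
  refine squeeze_zero' (.of_forall fun _ => norm_nonneg _) ?_ hbound
  filter_upwards [hpow] with n hn
  rw [← hn]
  exact norm_integral_exp_sub_pow_le hP hX hmarkov b _ (h _) (hl _)
    (fun i => single_le_sum (f := fun i => ‖h (t / √n) i - 1‖) (fun _ _ => norm_nonneg _)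
      (mem_univ i))
    (fun i => single_le_sum (f := fun i => ‖err (t / √n) i‖) (fun _ _ => norm_nonneg _)
      (mem_univ i)) n

end CharacteristicFunction

/-- One-dimensional central limit theorem for additive functionals of a finite
ergodic Markov chain: `n^{-1/2} ∑_{k=1}^n (a(X_k) - a*)` converges in
distribution to a centered Gaussian with variance `(σ*)²`. -/
theorem CLT_additive_functional_Markov_chain
    {Ω : Type*} [MeasurableSpace Ω] (Pr : Measure Ω) [IsProbabilityMeasure Pr]
    (m : ℕ) (hm : 1 ≤ m)
    (P : Matrix (Fin m) (Fin m) ℝ)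
    (hPnn : ∀ i j, 0 ≤ P i j)
    (hProw : ∀ i, ∑ j, P i j = 1)
    (hPprim : ∃ k : ℕ, ∀ i j, 0 < (P ^ k) i j)
    (π : Fin m → ℝ)
    (hπpos : ∀ i, 0 < π i) (hπsum : ∑ i, π i = 1)
    (hπstat : ∀ j, ∑ i, π i * P i j = π j)
    (X : ℕ → Ω → Fin m)
    (hXmeas : ∀ k, Measurable (X k))
    (hXmarkov : ∀ k : ℕ, 1 ≤ k → ∀ f : ℕ → Fin m,
      Pr (⋂ j ∈ Set.Icc 1 (k + 1), {ω | X j ω = f j})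
        = Pr (⋂ j ∈ Set.Icc 1 k, {ω | X j ω = f j}) * ENNReal.ofReal (P (f k) (f (k + 1))))
    (a : Fin m → ℝ)
    (astar : ℝ) (hastar : astar = ∑ i, π i * a i)
    (b : Fin m → ℝ) (hb : ∀ i, b i = a i - astar)
    (g : Fin m → ℝ) (hg : g = (P + Matrix.of (fun _ j => π j) - 1)⁻¹ *ᵥ b)
    (v : Fin m → ℝ)
    (hv : ∀ i, v i = (b i) ^ 2 + ∑ j, (g j - g i) ^ 2 * P i j
        - 2 * b i * ∑ j, (g j - g i) * P i j)
    (σ2 : ℝ) (hσ2 : σ2 = ∑ i, π i * v i) :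
    ∀ F : BoundedContinuousFunction ℝ ℝ,
      Tendsto (fun n : ℕ =>
          ∫ ω, F ((∑ k ∈ Finset.Icc 1 n, (a (X k ω) - astar)) / Real.sqrt n) ∂Pr)
        atTop
        (𝓝 (∫ x, F x ∂(gaussianReal 0 (Real.toNNReal σ2)))) := by
  have hP : P ∈ rowStochastic ℝ (Fin m) := mem_rowStochastic_iff_sum.2 ⟨hPnn, hProw⟩
  have hstat : π ᵥ* P = π := funext hπstat
  have hb0 : π ⬝ᵥ b = 0 := by
    simp only [dotProduct, hb, mul_sub, sum_sub_distrib, ← sum_mul, hπsum, ← hastar]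
    ring
  have hPg : P *ᵥ g = g + b := hg ▸ mulVec_inv_mulVec_eq_add hP hPprim hπsum hstat hb0
  have hv_sq (i : Fin m) : v i = ∑ j, P i j * (g j - g i - b i) ^ 2 := by
    have hexp : ∑ j, P i j * (g j - g i - b i) ^ 2 = ∑ j, (g j - g i) ^ 2 * P i j
        - 2 * b i * ∑ j, (g j - g i) * P i j + b i ^ 2 * ∑ j, P i j := by
      simp only [mul_sum, ← sum_sub_distrib, ← sum_add_distrib]
      exact sum_congr rfl fun j _ => by ring
    rw [hv, hexp, hProw]
    ring
  have hσ2_nonneg : 0 ≤ σ2 := by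
    rw [hσ2]
    refine sum_nonneg fun i _ => mul_nonneg (hπpos i).le ?_
    rw [hv_sq]
    exact sum_nonneg fun j _ => mul_nonneg (hPnn i j) (sq_nonneg _)
  have hσ2_eq : σ2 = ∑ i, π i * (b i ^ 2 - 2 * b i * (P *ᵥ g) i) := by
    have hvi (i : Fin m) : v i = (b i ^ 2 - 2 * b i * (P *ᵥ g) i) +
        ((P *ᵥ fun j => g j ^ 2) i - g i ^ 2) := by
      have hPgi := congrFun hPg i
      have hsum1 : ∑ j, (g j - g i) * P i j = (P *ᵥ g) i - g i := by
        simp only [mul_comm _ (P i _), mul_sub, sum_sub_distrib, ← sum_mul, hProw, mulVec,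
          dotProduct, one_mul]
      have hsum2 : ∑ j, (g j - g i) ^ 2 * P i j =
          (P *ᵥ fun j => g j ^ 2) i - 2 * g i * (P *ᵥ g) i + g i ^ 2 := by
        rw [← mul_one (g i ^ 2), ← hProw i]
        simp only [mulVec, dotProduct, mul_sum, ← sum_sub_distrib, ← sum_add_distrib]
        exact sum_congr rfl fun j _ => by ring
      simp only [Pi.add_apply] at hPgi
      rw [hv, hsum1, hsum2, hPgi]
      ring
    have hinv : π ⬝ᵥ (P *ᵥ fun j => g j ^ 2) = π ⬝ᵥ fun j => g j ^ 2 := by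
      rw [dotProduct_mulVec, hstat]
    simp only [dotProduct] at hinv
    rw [hσ2]
    simp only [hvi, mul_add, mul_sub, sum_add_distrib, sum_sub_distrib, hinv]
    ring
  let c (i : Fin m) : ℝ := b i ^ 2 / 2 - b i * (P *ᵥ g) i - σ2 / 2
  have hc0 : π ⬝ᵥ c = 0 := by
    have hsum : π ⬝ᵥ c = (∑ i, π i * (b i ^ 2 - 2 * b i * (P *ᵥ g) i)) / 2
        - (∑ i, π i) * (σ2 / 2) := by
      simp only [dotProduct, c, sum_div, sum_mul, ← sum_sub_distrib]
      exact sum_congr rfl fun i _ => by ring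
    rw [hsum, ← hσ2_eq, hπsum]
    ring
  have hchar := tendsto_integral_exp_additive_functional hPnn hProw hXmeas hXmarkov hσ2_nonneg hPg
    (congrFun (mulVec_inv_mulVec_eq_add hP hPprim hπsum hstat hc0))
  let S (n : ℕ) (ω : Ω) : ℝ := (∑ k ∈ Finset.Icc 1 n, (a (X k ω) - astar)) / √n
  have hS (n : ℕ) : Measurable (S n) := by
    have (k : ℕ) : Measurable fun ω => a (X k ω) := (measurable_of_finite a).comp (hXmeas k)
    fun_prop
  let law (n : ℕ) : ProbabilityMeasure ℝ :=
    ⟨Pr.map (S n), Measure.isProbabilityMeasure_map (hS n).aemeasurable⟩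
  let gauss : ProbabilityMeasure ℝ := ⟨gaussianReal 0 (Real.toNNReal σ2), inferInstance⟩
  have hlim : Tendsto law atTop (𝓝 gauss) := by
    refine ProbabilityMeasure.tendsto_iff_tendsto_charFun.2 fun t => ?_
    convert! hchar t using 2 with n
    · simp only [law, ProbabilityMeasure.coe_mk, charFun_apply_real]
      rw [integral_map (hS n).aemeasurable (by fun_prop)]
      refine integral_congr_ae (.of_forall fun ω => ?_)
      simp only [S, ← hb]
      push_cast
      ring_nf
    · simp only [gauss, ProbabilityMeasure.coe_mk, charFun_gaussianReal,
        Real.coe_toNNReal _ hσ2_nonneg]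
      congr 1
      push_cast
      ring
  intro F
  refine (ProbabilityMeasure.tendsto_iff_forall_integral_tendsto.1 hlim F).congr fun n => ?_
  exact integral_map (hS n).aemeasurable F.continuous.aestronglyMeasurable
end

section
/- Diffusion limit for the general compound Hawkes process with two-state dependent orders (Corollary 'Diffusion Limit for GCHP2SDO'): For every t > 0, (S_{nt} − N_{nt}·a*)/√n converges in distribution, as n → ∞, to a centered Gaussian random variable with variance (σ*)²·c·t, where a* := a₁π₁* + a₂π₂* and (σ*)² := π₁*a₁² + π₂*a₂² + (π₁*a₁ + π₂*a₂)[−2a₁π₁* − 2a₂π₂* + (π₁*a₁ + π₂*a₂)(π₁* + π₂*)] + (π₁*(1−p) + π₂*(1−p'))(a₁ − a₂)²/(p + p' − 2)² + 2(a₂ − a₁)[(π₂*a₂(1−p') − π₁*a₁(1−p))/(p + p' − 2) + (π₁*a₁ + π₂*a₂)(π₁* − pπ₁* − π₂* + p'π₂*)/(p + p' − 2)]. -/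
open MeasureTheory ProbabilityTheory Filter Finset Matrix Topology

lemma exp_mul_quadratic_isBigO (b h k : ℝ) :
    (fun v : ℝ => Complex.exp (Complex.I * v * b) * (1 + Complex.I * v * h + v ^ 2 * k)
      - (1 + Complex.I * v * (b + h) + v ^ 2 * (k - b ^ 2 / 2 - b * h)))
      =O[𝓝 0] fun v : ℝ => v ^ 3 := by
  have hexp : (fun v : ℝ => Complex.exp (Complex.I * v * b)
      - (1 + Complex.I * v * b - v ^ 2 * b ^ 2 / 2)) =O[𝓝 0] fun v : ℝ => v ^ 3 := by
    have hcont : ContinuousAt (fun v : ℝ => |b| ^ 3 * Real.exp (|v| * |b|)) 0 := by fun_prop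
    have hlt : ∀ᶠ v : ℝ in 𝓝 0, |b| ^ 3 * Real.exp (|v| * |b|) < |b| ^ 3 + 1 :=
      hcont.eventually_lt_const (by simp)
    refine Asymptotics.IsBigO.of_bound (|b| ^ 3 + 1) ?_
    filter_upwards [hlt] with v hv
    have key := Complex.norm_exp_sub_sum_le_norm_mul_exp (Complex.I * v * b) 3
    have hsum : ∑ m ∈ Finset.range 3, (Complex.I * v * b) ^ m / (m.factorial : ℂ)
        = 1 + Complex.I * v * b - v ^ 2 * b ^ 2 / 2 := by
      simp only [Finset.sum_range_succ, Finset.sum_range_zero, Nat.factorial, mul_pow,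
        Complex.I_sq]
      push_cast
      ring
    rw [hsum] at key
    refine key.trans ?_
    simp only [norm_mul, Complex.norm_I, one_mul, Complex.norm_real, Real.norm_eq_abs, norm_pow]
    rw [mul_pow]
    calc |v| ^ 3 * |b| ^ 3 * Real.exp (|v| * |b|) = |b| ^ 3 * Real.exp (|v| * |b|) * |v| ^ 3 := by
          ring
      _ ≤ (|b| ^ 3 + 1) * |v| ^ 3 := by gcongr
  have hw : (fun v : ℝ => (1 + Complex.I * v * h + v ^ 2 * k : ℂ)) =O[𝓝 0]
      fun _ : ℝ => (1 : ℝ) :=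
    (Continuous.tendsto (by fun_prop) 0).isBigO_one ℝ
  have hr : (fun v : ℝ => (Complex.I * (b * k - b ^ 2 * h / 2) - v * (b ^ 2 * k / 2) : ℂ))
      =O[𝓝 0] fun _ : ℝ => (1 : ℝ) :=
    (Continuous.tendsto (by fun_prop) 0).isBigO_one ℝ
  have hv3 : (fun v : ℝ => (v : ℂ) ^ 3) =O[𝓝 0] fun v : ℝ => v ^ 3 :=
    Asymptotics.IsBigO.of_bound 1 (by simp)
  have h1 := hexp.mul hw
  have h2 := hv3.mul hr
  simp only [mul_one] at h1 h2
  refine (h1.add h2).congr_left fun v => ?_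
  linear_combination -(v ^ 2 * b * h : ℂ) * Complex.I_sq

lemma perturbed_eigenvector_isBigO {ι : Type*} [Fintype ι] (P : ι → ι → ℝ)
    (hP1 : ∀ i, ∑ j, P i j = 1) (b h k : ι → ℝ) (s : ℝ)
    (hh : ∀ i, ∑ j, P i j * (b j + h j) = h i)
    (hk : ∀ i, ∑ j, P i j * (k j - b j ^ 2 / 2 - b j * h j) = k i - s / 2) (i : ι) :
    (fun v : ℝ => ∑ j, (P i j : ℂ) * (Complex.exp (Complex.I * v * b j)
        * (1 + Complex.I * v * h j + v ^ 2 * k j))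
      - Real.exp (-(s * v ^ 2 / 2)) * (1 + Complex.I * v * h i + v ^ 2 * k i))
      =O[𝓝 0] fun v : ℝ => v ^ 3 := by
  have h1 : (fun v : ℝ => ∑ j, (P i j : ℂ) * (Complex.exp (Complex.I * v * b j)
      * (1 + Complex.I * v * h j + v ^ 2 * k j)
      - (1 + Complex.I * v * (b j + h j) + v ^ 2 * (k j - b j ^ 2 / 2 - b j * h j))))
      =O[𝓝 0] fun v : ℝ => v ^ 3 :=
    Asymptotics.IsBigO.fun_sum fun j _ =>
      (exp_mul_quadratic_isBigO (b j) (h j) (k j)).const_mul_left _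
  have hρ : (fun v : ℝ => (Real.exp (-(s * v ^ 2 / 2)) - (1 - s * v ^ 2 / 2) : ℝ))
      =O[𝓝 0] fun v : ℝ => v ^ 4 := by
    have ht : Tendsto (fun v : ℝ => ‖-(s * v ^ 2 / 2)‖) (𝓝 0) (𝓝 0) := by
      have : Continuous fun v : ℝ => ‖-(s * v ^ 2 / 2)‖ := by fun_prop
      simpa using this.tendsto 0
    refine Asymptotics.IsBigO.of_bound (s ^ 2 / 4) ?_
    filter_upwards [ht.eventually_le_const one_pos] with v hv
    have := Real.norm_exp_sub_one_sub_id_le hv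
    calc _ = ‖Real.exp (-(s * v ^ 2 / 2)) - 1 - -(s * v ^ 2 / 2)‖ := by congr 1; ring
      _ ≤ _ := this
      _ = _ := by
        rw [Real.norm_eq_abs, sq_abs, Real.norm_eq_abs, abs_of_nonneg (by positivity)]; ring
  have hρ' : (fun v : ℝ => ((Real.exp (-(s * v ^ 2 / 2)) - (1 - s * v ^ 2 / 2) : ℝ) : ℂ))
      =O[𝓝 0] fun v : ℝ => v ^ 3 := by
    have h43 : (fun v : ℝ => v ^ 4) =O[𝓝 0] fun v : ℝ => v ^ 3 :=
      (Asymptotics.IsBigO.mul (Asymptotics.isBigO_refl (fun v : ℝ => v ^ 3) _)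
        (continuous_id.tendsto (0 : ℝ) |>.isBigO_one ℝ)).congr (fun v => by simp; ring) (by simp)
    exact (Asymptotics.isBigO_norm_left.1
      ((Asymptotics.isBigO_norm_left.2 (hρ.trans h43)).congr_left fun v => by
        rw [Complex.norm_real]))
  have hw : (fun v : ℝ => (1 + Complex.I * v * h i + v ^ 2 * k i : ℂ)) =O[𝓝 0]
      fun _ : ℝ => (1 : ℝ) :=
    (Continuous.tendsto (by fun_prop) 0).isBigO_one ℝ
  have hr : (fun v : ℝ => (s / 2 * (Complex.I * h i + v * k i) : ℂ))
      =O[𝓝 0] fun _ : ℝ => (1 : ℝ) :=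
    (Continuous.tendsto (by fun_prop) 0).isBigO_one ℝ
  have hv3 : (fun v : ℝ => (v : ℂ) ^ 3) =O[𝓝 0] fun v : ℝ => v ^ 3 :=
    Asymptotics.IsBigO.of_bound 1 (by simp)
  have h2 := hρ'.mul hw
  have h3 := hv3.mul hr
  simp only [mul_one] at h2 h3
  refine ((h1.sub h2).add h3).congr_left fun v => ?_
  have e1 : ∑ j, (P i j : ℂ) = 1 := mod_cast hP1 i
  have e2 : ∑ j, (P i j : ℂ) * (b j + h j) = h i := mod_cast hh i
  have e3 : ∑ j, (P i j : ℂ) * (k j - (b j : ℂ) ^ 2 / 2 - b j * h j) = (k i - s / 2 : ℂ) := by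
    have := congrArg (Complex.ofReal) (hk i)
    push_cast at this
    exact this
  have e4 : ∑ j, (P i j : ℂ) * (1 + Complex.I * v * (b j + h j)
      + v ^ 2 * (k j - (b j : ℂ) ^ 2 / 2 - b j * h j))
      = 1 + Complex.I * v * h i + v ^ 2 * (k i - s / 2) := by
    rw [← e2, ← e3, Finset.mul_sum, Finset.mul_sum, ← e1, ← Finset.sum_add_distrib,
      ← Finset.sum_add_distrib]
    exact Finset.sum_congr rfl fun j _ => by rw [e1]; ring
  simp only [mul_sub (P i _ : ℂ) (_ * _) (_ + _), Finset.sum_sub_distrib, e4]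
  push_cast
  ring

lemma integral_comp_eq_sum {Ω β : Type*} [MeasurableSpace Ω] {Pr : Measure Ω}
    [IsFiniteMeasure Pr] [Fintype β] [MeasurableSpace β] [MeasurableSingletonClass β]
    {Z : Ω → β} (hZ : Measurable Z) (G : β → ℂ) :
    ∫ ω, G (Z ω) ∂Pr = ∑ z, (Pr.real (Z ⁻¹' {z}) : ℂ) * G z := by
  have hG : Measurable G := measurable_of_finite G
  rw [← integral_map hZ.aemeasurable hG.aestronglyMeasurable, integral_fintype .of_finite]
  simp [map_measureReal_apply hZ (measurableSet_singleton _)]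

/-- One-step Markov property for functionals of the path up to time `k` and the next state. -/
lemma integral_markov_step {Ω ι : Type*} [MeasurableSpace Ω] {Pr : Measure Ω}
    [IsProbabilityMeasure Pr] [Fintype ι] [MeasurableSpace ι]
    [MeasurableSingletonClass ι] (P : ι → ι → ℝ) (hP0 : ∀ i j, 0 ≤ P i j)
    {X : ℕ → Ω → ι} (hX : ∀ k, Measurable (X k)) {k : ℕ} (hk : 1 ≤ k)
    (hmarkov : ∀ f : ℕ → ι, Pr (⋂ j ∈ Set.Icc 1 (k + 1), {ω | X j ω = f j})
        = Pr (⋂ j ∈ Set.Icc 1 k, {ω | X j ω = f j}) * ENNReal.ofReal (P (f k) (f (k + 1))))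
    (G : (Finset.Icc 1 k → ι) → ι → ℂ) :
    ∫ ω, G (fun j => X j ω) (X (k + 1) ω) ∂Pr
      = ∫ ω, ∑ j, (P (X k ω) j : ℂ) * G (fun j => X j ω) j ∂Pr := by
  have hkm : k ∈ Finset.Icc 1 k := Finset.mem_Icc.2 ⟨hk, le_rfl⟩
  have hZ : Measurable fun ω => (fun j : Finset.Icc 1 k => X j ω) :=
    measurable_pi_lambda _ fun j => hX j
  rw [integral_comp_eq_sum (hZ.prodMk (hX (k + 1))) fun z => G z.1 z.2,
    integral_comp_eq_sum hZ fun z => ∑ j, (P (z ⟨k, hkm⟩) j : ℂ) * G z j,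
    Fintype.sum_prod_type]
  refine Finset.sum_congr rfl fun z _ => ?_
  rw [Finset.mul_sum]
  refine Finset.sum_congr rfl fun j _ => ?_
  rw [← mul_assoc, ← Complex.ofReal_mul]
  congr 2
  set f : ℕ → ι := fun m => if h : m ∈ Finset.Icc 1 k then z ⟨m, h⟩ else j with hf
  have hfk : f k = z ⟨k, hkm⟩ := by simp only [hf, dif_pos hkm]
  have hfk1 : f (k + 1) = j := by simp [hf]
  have hfz : ∀ m : Finset.Icc 1 k, f m = z m := fun m => by simp only [hf, dif_pos m.2]
  have hA : (fun ω => (fun j : Finset.Icc 1 k => X j ω)) ⁻¹' {z}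
      = ⋂ j ∈ Set.Icc 1 k, {ω | X j ω = f j} := by
    ext ω
    simp only [Set.mem_preimage, Set.mem_singleton_iff, funext_iff, Set.mem_iInter,
      Set.mem_ofPred_eq, ← hfz]
    exact ⟨fun h m hm => h ⟨m, Finset.mem_Icc.2 hm⟩, fun h m => h m (Finset.mem_Icc.1 m.2)⟩
  have hB : (fun ω => ((fun j : Finset.Icc 1 k => X j ω), X (k + 1) ω)) ⁻¹' {(z, j)}
      = ⋂ j ∈ Set.Icc 1 (k + 1), {ω | X j ω = f j} := by
    have : Set.Icc 1 (k + 1) = insert (k + 1) (Set.Icc 1 k) := by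
      ext m; simp only [Set.mem_Icc, Set.mem_insert_iff]; omega
    rw [this, Set.biInter_insert, ← hA, hfk1]
    ext ω
    simp [and_comm]
  rw [hA, hB, measureReal_def, measureReal_def, hmarkov f, ENNReal.toReal_mul,
    ENNReal.toReal_ofReal (hP0 _ _), hfk, hfk1]

lemma norm_sub_pow_mul_le_s7 {x : ℕ → ℂ} {ρ : ℂ} (hρ : ‖ρ‖ ≤ 1) {ε : ℝ}
    (hx : ∀ m, ‖x (m + 1) - ρ * x m‖ ≤ ε) (m : ℕ) : ‖x m - ρ ^ m * x 0‖ ≤ m * ε := by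
  induction m with
  | zero => simp
  | succ m ih =>
    calc ‖x (m + 1) - ρ ^ (m + 1) * x 0‖
        = ‖(x (m + 1) - ρ * x m) + ρ * (x m - ρ ^ m * x 0)‖ := by congr 1; ring
      _ ≤ ‖x (m + 1) - ρ * x m‖ + ‖ρ‖ * ‖x m - ρ ^ m * x 0‖ :=
        (norm_add_le _ _).trans_eq (by rw [norm_mul])
      _ ≤ ε + 1 * (m * ε) := by gcongr; exact hx m
      _ = ((m + 1 : ℕ) : ℝ) * ε := by push_cast; ring

lemma exp_mul_quadratic_sub_one_isBigO (b h k : ℝ) :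
    (fun v : ℝ => Complex.exp (Complex.I * v * b) * (1 + Complex.I * v * h + v ^ 2 * k) - 1)
      =O[𝓝 0] fun v : ℝ => v := by
  have hd : DifferentiableAt ℝ (fun v : ℝ =>
      Complex.exp (Complex.I * v * b) * (1 + Complex.I * v * h + v ^ 2 * k)) 0 := by
    have h0 : DifferentiableAt ℝ (fun v : ℝ => (v : ℂ)) 0 := Complex.ofRealCLM.differentiableAt
    fun_prop
  simpa using hd.isBigO_sub

/-- Quantitative characteristic function estimate for additive functionals of a finite Markov
chain, given solutions `h`, `k` of the Poisson equations of first and second order. -/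
lemma exists_norm_integral_exp_sub_le {Ω ι : Type*} [MeasurableSpace Ω] {Pr : Measure Ω}
    [IsProbabilityMeasure Pr] [Fintype ι] [MeasurableSpace ι]
    [MeasurableSingletonClass ι] (P : ι → ι → ℝ) (hP0 : ∀ i j, 0 ≤ P i j)
    (hP1 : ∀ i, ∑ j, P i j = 1) {X : ℕ → Ω → ι} (hX : ∀ k, Measurable (X k))
    (hmarkov : ∀ k : ℕ, 1 ≤ k → ∀ f : ℕ → ι, Pr (⋂ j ∈ Set.Icc 1 (k + 1), {ω | X j ω = f j})
        = Pr (⋂ j ∈ Set.Icc 1 k, {ω | X j ω = f j}) * ENNReal.ofReal (P (f k) (f (k + 1))))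
    (b h k : ι → ℝ) {s : ℝ} (hs : 0 ≤ s)
    (hh : ∀ i, ∑ j, P i j * (b j + h j) = h i)
    (hk : ∀ i, ∑ j, P i j * (k j - b j ^ 2 / 2 - b j * h j) = k i - s / 2) :
    ∃ C : ℝ, ∀ᶠ v : ℝ in 𝓝 0, ∀ m : ℕ,
      ‖∫ ω, Complex.exp (Complex.I * v * (∑ j ∈ Finset.Icc 1 m, b (X j ω) : ℝ)) ∂Pr
        - (Real.exp (-(s * v ^ 2 / 2)) : ℂ) ^ m‖ ≤ C * (|v| + m * |v| ^ 3) := by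
  have hP : (fun v : ℝ => ∑ i, ‖∑ j, (P i j : ℂ) * (Complex.exp (Complex.I * v * b j)
        * (1 + Complex.I * v * h j + v ^ 2 * k j))
      - Real.exp (-(s * v ^ 2 / 2)) * (1 + Complex.I * v * h i + v ^ 2 * k i)‖)
      =O[𝓝 0] fun v : ℝ => v ^ 3 :=
    Asymptotics.IsBigO.fun_sum fun i _ =>
      (perturbed_eigenvector_isBigO P hP1 b h k s hh hk i).norm_left
  have hw : (fun v : ℝ => ∑ i, ‖(1 + Complex.I * v * h i + v ^ 2 * k i) - 1‖)
      =O[𝓝 0] fun v : ℝ => v :=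
    Asymptotics.IsBigO.fun_sum fun i _ => by
      simpa using (exp_mul_quadratic_sub_one_isBigO 0 (h i) (k i)).norm_left
  have hew : (fun v : ℝ => ∑ i, ‖Complex.exp (Complex.I * v * b i)
      * (1 + Complex.I * v * h i + v ^ 2 * k i) - 1‖) =O[𝓝 0] fun v : ℝ => v :=
    Asymptotics.IsBigO.fun_sum fun i _ => (exp_mul_quadratic_sub_one_isBigO _ _ _).norm_left
  have hρ : (fun v : ℝ => Real.exp (-(s * v ^ 2 / 2)) - 1) =O[𝓝 0] fun v : ℝ => v := by
    have hd : DifferentiableAt ℝ (fun v : ℝ => Real.exp (-(s * v ^ 2 / 2))) 0 := by fun_prop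
    simpa using hd.isBigO_sub
  obtain ⟨C₁, hC₁0, hC₁⟩ := hP.exists_nonneg
  obtain ⟨C₂, hC₂0, hC₂⟩ := hw.exists_nonneg
  obtain ⟨C₃, hC₃0, hC₃⟩ := hew.exists_nonneg
  obtain ⟨C₄, hC₄0, hC₄⟩ := hρ.exists_nonneg
  refine ⟨C₁ + C₂ + C₃ + C₄, ?_⟩
  filter_upwards [hC₁.bound, hC₂.bound, hC₃.bound, hC₄.bound] with v h₁ h₂ h₃ h₄ m
  have le_of_sum {f : ι → ℂ} {B : ℝ} (hB : ‖∑ i, ‖f i‖‖ ≤ B) (i : ι) : ‖f i‖ ≤ B :=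
    (Finset.single_le_sum (f := fun i => ‖f i‖) (fun _ _ => norm_nonneg _)
      (Finset.mem_univ i)).trans ((le_abs_self _).trans hB)
  replace h₁ := le_of_sum h₁
  replace h₂ := le_of_sum h₂
  replace h₃ := le_of_sum h₃
  simp only [norm_pow, Real.norm_eq_abs] at h₁ h₂ h₃ h₄
  set w : ι → ℂ := fun i => 1 + Complex.I * v * h i + v ^ 2 * k i
  set ρ : ℝ := Real.exp (-(s * v ^ 2 / 2))
  set E : ℕ → Ω → ℂ := fun m ω =>
    Complex.exp (Complex.I * v * (∑ j ∈ Finset.Icc 1 m, b (X j ω) : ℝ)) with hE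
  have hb : Measurable b := measurable_of_finite b
  have hEm : ∀ m, Measurable (E m) := fun m => by
    have : Measurable fun ω => ∑ j ∈ Finset.Icc 1 m, b (X j ω) :=
      Finset.measurable_fun_sum _ fun j _ => hb.comp (hX j)
    fun_prop
  have hEn : ∀ m ω, ‖E m ω‖ = 1 := fun m ω => by
    simp only [hE]
    rw [mul_assoc, ← Complex.ofReal_mul, Complex.norm_exp_I_mul_ofReal]
  have hEg (m : ℕ) {g : ι → ℂ} (l : ℕ) : Integrable (fun ω => E m ω * g (X l ω)) Pr := by
    have hg : Measurable g := measurable_of_finite g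
    refine Integrable.of_bound (C := ∑ i, ‖g i‖)
      ((hEm m).mul (hg.comp (hX l))).aestronglyMeasurable (ae_of_all _ fun ω => ?_)
    rw [norm_mul, hEn, one_mul]
    exact Finset.single_le_sum (f := fun i => ‖g i‖) (fun _ _ => norm_nonneg _) (Finset.mem_univ _)
  have hEint (m : ℕ) : Integrable (E m) Pr := by
    simpa using hEg m (g := fun _ => 1) 0
  have hbound (m l : ℕ) (g : ι → ℂ) {B : ℝ} (hg : ∀ i, ‖g i‖ ≤ B) :
      ‖∫ ω, E m ω * g (X l ω) ∂Pr‖ ≤ B := by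
    have := norm_integral_le_of_norm_le_const (μ := Pr) (f := fun ω => E m ω * g (X l ω))
      (C := B) (ae_of_all _ fun ω => by rw [norm_mul, hEn, one_mul]; exact hg _)
    simpa using this
  have hρ0 : 0 ≤ ρ := (Real.exp_pos _).le
  have hρ1 : ρ ≤ 1 := Real.exp_le_one_iff.2 (by have := mul_nonneg hs (sq_nonneg v); linarith)
  have hρn : ‖(ρ : ℂ)‖ ≤ 1 := by rwa [Complex.norm_real, Real.norm_of_nonneg hρ0]
  set x : ℕ → ℂ := fun m => ∫ ω, E (m + 1) ω * w (X (m + 1) ω) ∂Pr with hx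
  have hstep : ∀ m, ‖x (m + 1) - ρ * x m‖ ≤ C₁ * |v| ^ 3 := fun m => by
    have key := integral_markov_step P hP0 hX (Nat.le_add_left 1 m)
      (hmarkov _ (Nat.le_add_left 1 m))
      (fun z j => Complex.exp (Complex.I * v * (∑ i, b (z i) : ℝ))
        * (Complex.exp (Complex.I * v * b j) * w j))
    have hsum : ∀ ω, ∑ i : Finset.Icc 1 (m + 1), b (X i ω)
        = ∑ i ∈ Finset.Icc 1 (m + 1), b (X i ω) := fun ω =>
      Finset.sum_coe_sort (Finset.Icc 1 (m + 1)) fun i => b (X i ω)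
    simp only [hsum] at key
    have e1 : x (m + 1) = ∫ ω, E (m + 1) ω *
        (∑ j, (P (X (m + 1) ω) j : ℂ) * (Complex.exp (Complex.I * v * b j) * w j)) ∂Pr := by
      refine Eq.trans (integral_congr_ae (ae_of_all _ fun ω => ?_))
        (key.trans (integral_congr_ae (ae_of_all _ fun ω => ?_)))
      · simp only [hE]
        rw [Finset.sum_Icc_succ_top (by omega), ← mul_assoc, ← Complex.exp_add]
        push_cast
        ring_nf
      · simp only [hE]
        rw [Finset.mul_sum]
        exact Finset.sum_congr rfl fun j _ => by ring
    rw [e1, hx, ← integral_const_mul, ← integral_sub (hEg _ (g := fun i =>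
      ∑ j, (P i j : ℂ) * (Complex.exp (Complex.I * v * b j) * w j)) _) ((hEg _ _).const_mul _)]
    simp only [mul_left_comm (ρ : ℂ), ← mul_sub]
    exact hbound (m + 1) (m + 1) (fun i => ∑ j, (P i j : ℂ)
      * (Complex.exp (Complex.I * v * b j) * w j) - ρ * w i) h₁
  have hv : 0 ≤ |v| := abs_nonneg v
  rcases m with _ | m
  · simp
    positivity
  · have d1 : ‖∫ ω, E (m + 1) ω ∂Pr - x m‖ ≤ C₂ * |v| := by
      rw [norm_sub_rev, hx, ← integral_sub (hEg _ _) (hEint _)]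
      have := hbound (m + 1) (m + 1) (fun i => w i - 1) h₂
      simpa only [mul_sub, mul_one] using this
    have d2 : ‖x m - ρ ^ m * x 0‖ ≤ m * (C₁ * |v| ^ 3) := norm_sub_pow_mul_le_s7 hρn hstep m
    have d3 : ‖x 0 - 1‖ ≤ C₃ * |v| := by
      have := hbound 0 1 (fun i => Complex.exp (Complex.I * v * b i) * w i - 1) h₃
      have e0 : ∀ ω, E 0 ω = 1 := fun ω => by simp [hE]
      simp only [e0, one_mul] at this
      have hi : Integrable (fun ω => Complex.exp (Complex.I * v * b (X 1 ω)) * w (X 1 ω)) Pr := by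
        simpa [e0] using hEg 0 1 (g := fun i => Complex.exp (Complex.I * v * b i) * w i)
      rw [integral_sub hi (integrable_const _)] at this
      simpa [hx, hE] using this
    have d4 : ‖(1 : ℂ) - ρ‖ ≤ C₄ * |v| := by
      rw [norm_sub_rev, ← Complex.ofReal_one, ← Complex.ofReal_sub, Complex.norm_real]
      exact h₄
    have hpow : ‖(ρ : ℂ) ^ m‖ ≤ 1 := by
      rw [norm_pow]; exact pow_le_one₀ (norm_nonneg _) hρn
    calc ‖∫ ω, E (m + 1) ω ∂Pr - (ρ : ℂ) ^ (m + 1)‖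
        = ‖(∫ ω, E (m + 1) ω ∂Pr - x m) + (x m - ρ ^ m * x 0)
            + (ρ ^ m * (x 0 - 1) + ρ ^ m * (1 - ρ))‖ := by congr 1; ring
      _ ≤ ‖∫ ω, E (m + 1) ω ∂Pr - x m‖ + ‖x m - ρ ^ m * x 0‖
            + (‖(ρ : ℂ) ^ m‖ * ‖x 0 - 1‖ + ‖(ρ : ℂ) ^ m‖ * ‖1 - (ρ : ℂ)‖) := by
        simp only [← norm_mul]
        exact (norm_add_le _ _).trans (add_le_add (norm_add_le _ _) (norm_add_le _ _))
      _ ≤ C₂ * |v| + m * (C₁ * |v| ^ 3) + (1 * (C₃ * |v|) + 1 * (C₄ * |v|)) := by gcongr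
      _ ≤ (C₁ + C₂ + C₃ + C₄) * (|v| + ((m + 1 : ℕ) : ℝ) * |v| ^ 3) := by
        push_cast
        have h3 : 0 ≤ |v| ^ 3 := by positivity
        have hm : (0 : ℝ) ≤ m := m.cast_nonneg
        have : 0 ≤ C₁ * |v| + C₁ * |v| ^ 3 + (C₂ + C₃ + C₄) * ((m + 1) * |v| ^ 3) := by positivity
        linarith

lemma tendsto_of_norm_sub_exp_pow_le {φ : ℕ → ℝ → ℂ} {C s : ℝ}
    (hφ : ∀ᶠ v : ℝ in 𝓝 0, ∀ m : ℕ,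
      ‖φ m v - (Real.exp (-(s * v ^ 2 / 2)) : ℂ) ^ m‖ ≤ C * (|v| + m * |v| ^ 3))
    {m : ℕ → ℕ} {τ : ℝ} (hm : Tendsto (fun n : ℕ => (m n : ℝ) / n) atTop (𝓝 τ)) (u : ℝ) :
    Tendsto (fun n : ℕ => φ (m n) (u / √n)) atTop
      (𝓝 (Real.exp (-(s * τ * u ^ 2 / 2)) : ℂ)) := by
  have hv : Tendsto (fun n : ℕ => u / √(n : ℝ)) atTop (𝓝 0) :=
    tendsto_const_nhds.div_atTop (Real.tendsto_sqrt_atTop.comp tendsto_natCast_atTop_atTop)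
  have hsq : ∀ n : ℕ, (u / √(n : ℝ)) ^ 2 = u ^ 2 / n := fun n => by
    rw [div_pow, Real.sq_sqrt n.cast_nonneg]
  have hpow : Tendsto (fun n : ℕ => (Real.exp (-(s * (u / √(n : ℝ)) ^ 2 / 2)) : ℂ) ^ m n) atTop
      (𝓝 (Real.exp (-(s * τ * u ^ 2 / 2)) : ℂ)) := by
    have h1 : Tendsto (fun n : ℕ => Real.exp (-(s * ((m n : ℝ) / n) * u ^ 2 / 2))) atTop
        (𝓝 (Real.exp (-(s * τ * u ^ 2 / 2)))) :=
      (Real.continuous_exp.tendsto _).comp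
        ((((hm.const_mul s).mul_const (u ^ 2)).div_const 2).neg)
    refine ((Complex.continuous_ofReal.tendsto _).comp h1).congr fun n => ?_
    rw [Function.comp_apply, ← Complex.ofReal_pow, ← Real.exp_nat_mul, hsq]
    congr 2
    ring
  have hdiff : Tendsto (fun n : ℕ => φ (m n) (u / √n)
      - (Real.exp (-(s * (u / √(n : ℝ)) ^ 2 / 2)) : ℂ) ^ m n) atTop (𝓝 0) := by
    have hlim : Tendsto (fun n : ℕ => C * (|u / √(n : ℝ)|
        + (m n : ℝ) / n * u ^ 2 * |u / √(n : ℝ)|)) atTop (𝓝 0) := by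
      have := (hv.abs.add ((hm.mul_const (u ^ 2)).mul hv.abs)).const_mul C
      simpa using this
    refine squeeze_zero_norm' ?_ hlim
    filter_upwards [hv.eventually hφ] with n hn
    refine (hn (m n)).trans_eq ?_
    rw [pow_succ, sq_abs, hsq]
    ring
  simpa using hdiff.add hpow

lemma integral_eq_integral_integral_of_indepFun {Ω E : Type*} [MeasurableSpace Ω]
    [MeasurableSpace E] {Pr : Measure Ω} [IsProbabilityMeasure Pr] {M : Ω → ℕ} {Y : Ω → E}
    (hM : Measurable M) (hY : Measurable Y) (hindep : IndepFun M Y Pr) {g : ℕ → E → ℂ}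
    (hg : ∀ m, Measurable (g m)) {C : ℝ} (hgC : ∀ m y, ‖g m y‖ ≤ C) :
    ∫ ω, g (M ω) (Y ω) ∂Pr = ∫ ω, ∫ ω', g (M ω) (Y ω') ∂Pr ∂Pr := by
  have hgm : Measurable fun z : ℕ × E => g z.1 z.2 := measurable_from_prod_countable_right hg
  have := Measure.isProbabilityMeasure_map (μ := Pr) hM.aemeasurable
  have := Measure.isProbabilityMeasure_map (μ := Pr) hY.aemeasurable
  calc ∫ ω, g (M ω) (Y ω) ∂Pr
      = ∫ z, g z.1 z.2 ∂(Pr.map fun ω => (M ω, Y ω)) :=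
        (integral_map (hM.prodMk hY).aemeasurable hgm.aestronglyMeasurable).symm
    _ = ∫ z, g z.1 z.2 ∂((Pr.map M).prod (Pr.map Y)) := by
        rw [(indepFun_iff_map_prod_eq_prod_map_map hM.aemeasurable hY.aemeasurable).1 hindep]
    _ = ∫ m, ∫ y, g m y ∂(Pr.map Y) ∂(Pr.map M) :=
        integral_prod _ (Integrable.of_bound hgm.aestronglyMeasurable C
          (ae_of_all _ fun z => hgC _ _))
    _ = ∫ ω, ∫ y, g (M ω) y ∂(Pr.map Y) ∂Pr :=
        integral_map hM.aemeasurable (measurable_of_countable _).aestronglyMeasurable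
    _ = ∫ ω, ∫ ω', g (M ω) (Y ω') ∂Pr ∂Pr := by
        simp_rw [integral_map hY.aemeasurable (hg _).aestronglyMeasurable]

/-- Central limit theorem for randomly stopped sums `∑ k ≤ M n, b (X k)`, where the index `M n` is
independent of `X` and `M n / n → τ`, under an estimate of the characteristic functions. -/
lemma tendsto_integral_stoppedSum {Ω ι : Type*} [MeasurableSpace Ω] {Pr : Measure Ω}
    [IsProbabilityMeasure Pr] [MeasurableSpace ι] {X : ℕ → Ω → ι} (hX : ∀ k, Measurable (X k))
    {b : ι → ℝ} (hb : Measurable b) {C s : ℝ} (hs : 0 ≤ s)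
    (hchar : ∀ᶠ v : ℝ in 𝓝 0, ∀ m : ℕ,
      ‖∫ ω, Complex.exp (Complex.I * v * (∑ j ∈ Finset.Icc 1 m, b (X j ω) : ℝ)) ∂Pr
        - (Real.exp (-(s * v ^ 2 / 2)) : ℂ) ^ m‖ ≤ C * (|v| + m * |v| ^ 3))
    {M : ℕ → Ω → ℕ} (hM : ∀ n, Measurable (M n))
    (hindep : ∀ n, IndepFun (M n) (fun ω k => X k ω) Pr) {τ : ℝ} (hτ : 0 ≤ τ)
    (hMτ : ∀ᵐ ω ∂Pr, Tendsto (fun n : ℕ => (M n ω : ℝ) / n) atTop (𝓝 τ)) (x₀ : ℝ)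
    (F : BoundedContinuousFunction ℝ ℝ) :
    Tendsto (fun n : ℕ => ∫ ω, F ((x₀ + ∑ k ∈ Finset.Icc 1 (M n ω), b (X k ω)) / √n) ∂Pr) atTop
      (𝓝 (∫ x, F x ∂(gaussianReal 0 (Real.toNNReal (s * τ))))) := by
  have hXm : Measurable fun ω k => X k ω := measurable_pi_lambda _ hX
  have hsum : ∀ m : ℕ, Measurable fun x : ℕ → ι => ∑ k ∈ Finset.Icc 1 m, b (x k) := fun m =>
    Finset.measurable_fun_sum _ fun k _ => hb.comp (measurable_pi_apply k)
  have hZ : ∀ n : ℕ, Measurable fun ω => (x₀ + ∑ k ∈ Finset.Icc 1 (M n ω), b (X k ω)) / √n :=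
    fun n => by
      have : Measurable fun z : ℕ × (ℕ → ι) => ∑ k ∈ Finset.Icc 1 z.1, b (z.2 k) :=
        measurable_from_prod_countable_right hsum
      exact ((this.comp ((hM n).prodMk hXm)).const_add x₀).div_const _
  let μ : ℕ → ProbabilityMeasure ℝ := fun n =>
    ⟨Pr.map fun ω => (x₀ + ∑ k ∈ Finset.Icc 1 (M n ω), b (X k ω)) / √n,
      Measure.isProbabilityMeasure_map (hZ n).aemeasurable⟩
  let γ : ProbabilityMeasure ℝ := ⟨gaussianReal 0 (Real.toNNReal (s * τ)), inferInstance⟩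
  suffices h : Tendsto μ atTop (𝓝 γ) by
    refine (ProbabilityMeasure.tendsto_iff_forall_integral_tendsto.1 h F).congr fun n => ?_
    exact integral_map (hZ n).aemeasurable F.continuous.measurable.aestronglyMeasurable
  refine ProbabilityMeasure.tendsto_iff_tendsto_charFun.2 fun u => ?_
  have hγ : charFun (γ : Measure ℝ) u = (Real.exp (-(s * τ * u ^ 2 / 2)) : ℂ) := by
    change charFun (gaussianReal 0 (Real.toNNReal (s * τ))) u = _
    rw [charFun_gaussianReal, Real.coe_toNNReal _ (mul_nonneg hs hτ)]
    push_cast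
    congr 1
    ring
  have hμ : ∀ n, charFun (μ n : Measure ℝ) u = Complex.exp (Complex.I * (u / √n : ℝ) * x₀)
      * ∫ ω, ∫ ω', Complex.exp (Complex.I * (u / √n : ℝ)
        * (∑ j ∈ Finset.Icc 1 (M n ω), b (X j ω') : ℝ)) ∂Pr ∂Pr := fun n => by
    change charFun (Pr.map _) u = _
    rw [charFun_apply_real, integral_map (hZ n).aemeasurable (by fun_prop),
      ← integral_eq_integral_integral_of_indepFun (hM n) hXm (hindep n)
        (g := fun m x => Complex.exp (Complex.I * (u / √n : ℝ)
          * (∑ j ∈ Finset.Icc 1 m, b (x j) : ℝ))) (C := 1)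
        (fun m => by have := hsum m; fun_prop)
        (fun m x => by
          rw [mul_assoc, ← Complex.ofReal_mul, Complex.norm_exp_I_mul_ofReal]),
      ← integral_const_mul]
    refine integral_congr_ae (ae_of_all _ fun ω => ?_)
    simp only
    rw [← Complex.exp_add]
    push_cast
    congr 1
    ring
  rw [hγ]
  simp only [hμ]
  have h1 : Tendsto (fun n : ℕ => Complex.exp (Complex.I * (u / √n : ℝ) * x₀)) atTop (𝓝 1) := by
    have hv : Tendsto (fun n : ℕ => u / √(n : ℝ)) atTop (𝓝 0) :=
      tendsto_const_nhds.div_atTop (Real.tendsto_sqrt_atTop.comp tendsto_natCast_atTop_atTop)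
    have hc : Continuous fun v : ℝ => Complex.exp (Complex.I * v * x₀) := by fun_prop
    simpa [Function.comp_def] using (hc.tendsto 0).comp hv
  have h2 : Tendsto (fun n : ℕ => ∫ ω, ∫ ω', Complex.exp (Complex.I * (u / √n : ℝ)
        * (∑ j ∈ Finset.Icc 1 (M n ω), b (X j ω') : ℝ)) ∂Pr ∂Pr) atTop
      (𝓝 (∫ _, (Real.exp (-(s * τ * u ^ 2 / 2)) : ℂ) ∂Pr)) := by
    refine tendsto_integral_of_dominated_convergence (fun _ => 1) (fun n => ?_)
      (integrable_const _) (fun n => ae_of_all _ fun ω => ?_) ?_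
    · exact ((measurable_of_countable fun m : ℕ => ∫ ω', Complex.exp (Complex.I * (u / √n : ℝ)
        * (∑ j ∈ Finset.Icc 1 m, b (X j ω') : ℝ)) ∂Pr).comp (hM n)).aestronglyMeasurable
    · refine (norm_integral_le_of_norm_le_const (C := 1) (ae_of_all _ fun ω' => ?_)).trans
        (by simp)
      rw [mul_assoc, ← Complex.ofReal_mul, Complex.norm_exp_I_mul_ofReal]
    · filter_upwards [hMτ] with ω hω
      exact tendsto_of_norm_sub_exp_pow_le (φ := fun m v => ∫ ω', Complex.exp (Complex.I * v
        * (∑ j ∈ Finset.Icc 1 m, b (X j ω') : ℝ)) ∂Pr) hchar hω u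
  simpa using h1.mul h2

/-- Diffusion limit for the general compound Hawkes process with two-state
dependent orders (Corollary "Diffusion Limit for GCHP2SDO"): for every `t > 0`,
`(S_{nt} - N_{nt} a*)/√n` converges in distribution to a centered Gaussian with
variance `(σ*)² c t`, with the explicit two-state formulas for `a*` and `(σ*)²`. -/
theorem diffusion_limit_GCHP2SDO
    {Ω : Type*} [MeasurableSpace Ω] (Pr : Measure Ω) [IsProbabilityMeasure Pr]
    (p p' : ℝ) (hp : 0 < p) (hp1 : p < 1) (hp' : 0 < p') (hp'1 : p' < 1)
    (P : Matrix (Fin 2) (Fin 2) ℝ) (hP : P = !![p, 1 - p; 1 - p', p'])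
    (π₁ π₂ : ℝ) (hπ₁pos : 0 < π₁) (hπ₂pos : 0 < π₂) (hπsum : π₁ + π₂ = 1)
    (hπstat₁ : π₁ * p + π₂ * (1 - p') = π₁)
    (hπstat₂ : π₁ * (1 - p) + π₂ * p' = π₂)
    (X : ℕ → Ω → Fin 2)
    (hXmeas : ∀ k, Measurable (X k))
    (hXmarkov : ∀ k : ℕ, 1 ≤ k → ∀ f : ℕ → Fin 2,
      Pr (⋂ j ∈ Set.Icc 1 (k + 1), {ω | X j ω = f j})
        = Pr (⋂ j ∈ Set.Icc 1 k, {ω | X j ω = f j}) * ENNReal.ofReal (P (f k) (f (k + 1))))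
    (a₁ a₂ : ℝ) (a : Fin 2 → ℝ) (ha : a = ![a₁, a₂])
    (astar : ℝ) (hastar : astar = a₁ * π₁ + a₂ * π₂)
    (σ2 : ℝ)
    (hσ2 : σ2 = π₁ * a₁ ^ 2 + π₂ * a₂ ^ 2
      + (π₁ * a₁ + π₂ * a₂) * (-2 * a₁ * π₁ - 2 * a₂ * π₂
          + (π₁ * a₁ + π₂ * a₂) * (π₁ + π₂))
      + (π₁ * (1 - p) + π₂ * (1 - p')) * (a₁ - a₂) ^ 2 / (p + p' - 2) ^ 2
      + 2 * (a₂ - a₁) * ((π₂ * a₂ * (1 - p') - π₁ * a₁ * (1 - p)) / (p + p' - 2)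
          + (π₁ * a₁ + π₂ * a₂) * (π₁ - p * π₁ - π₂ + p' * π₂) / (p + p' - 2)))
    (N : ℝ → Ω → ℕ)
    (hNmeas : ∀ t, Measurable (N t))
    (hN0 : ∀ ω, N 0 ω = 0)
    (hNmono : ∀ ω, Monotone (fun t => N t ω))
    (hNrc : ∀ ω t, ContinuousWithinAt (fun s => (N s ω : ℝ)) (Set.Ici t) t)
    (c : ℝ) (hc : 0 < c)
    (hNLLN : ∀ᵐ ω ∂Pr, Tendsto (fun t : ℝ => (N t ω : ℝ) / t) atTop (𝓝 c))
    (hindep : IndepFun (fun ω (t : ℝ) => N t ω) (fun ω (k : ℕ) => X k ω) Pr)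
    (S0 : ℝ) (S : ℝ → Ω → ℝ)
    (hS : ∀ t ω, S t ω = S0 + ∑ k ∈ Finset.Icc 1 (N t ω), a (X k ω))
    (t : ℝ) (ht : 0 < t) :
    ∀ F : BoundedContinuousFunction ℝ ℝ,
      Tendsto (fun n : ℕ =>
          ∫ ω, F ((S (n * t) ω - (N (n * t) ω : ℝ) * astar) / Real.sqrt n) ∂Pr)
        atTop
        (𝓝 (∫ x, F x ∂(gaussianReal 0 (Real.toNNReal (σ2 * c * t))))) := by
  have hq : 0 < 2 - p - p' := by linarith
  have hq0 : 2 - p - p' ≠ 0 := hq.ne'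
  obtain rfl : π₂ = 1 - π₁ := by linarith
  have hπ₁ : π₁ = (1 - p') / (2 - p - p') := by
    rw [eq_div_iff hq0]
    linarith
  set b : Fin 2 → ℝ := fun i => a i - astar with hb
  have hb0 : b 0 = (a₁ - a₂) * (1 - p) / (2 - p - p') := by
    simp only [hb, ha, hastar, hπ₁, Matrix.cons_val_zero]
    field_simp
    ring
  have hb1 : b 1 = -((a₁ - a₂) * (1 - p') / (2 - p - p')) := by
    simp only [hb, ha, hastar, hπ₁, Matrix.cons_val_one, Matrix.cons_val_fin_one]
    field_simp
    ring
  have hσ : σ2 = (1 - p) * (1 - p') * (a₁ - a₂) ^ 2 * (p + p') / (2 - p - p') ^ 3 := by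
    have hneg : p + p' - 2 = -(2 - p - p') := by ring
    rw [hσ2, hneg, hπ₁]
    field_simp
    ring
  have hσ0 : 0 ≤ σ2 := by
    rw [hσ]
    have h1 : 0 < 1 - p := by linarith
    have h2 : 0 < 1 - p' := by linarith
    positivity
  obtain ⟨C, hC⟩ := exists_norm_integral_exp_sub_le (fun i j => P i j)
    (by
      subst hP
      intro i j
      fin_cases i <;> fin_cases j <;> simp <;> linarith)
    (by
      subst hP
      intro i
      fin_cases i <;> simp)
    hXmeas hXmarkov b
    (fun i => (p + p' - 1) / (2 - p - p') * b i)
    (fun i => -((p + p' - 1) * (p + p') / (2 * (2 - p - p') ^ 2))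
      * (b i ^ 2 - (1 - p) * (1 - p') * (a₁ - a₂) ^ 2 / (2 - p - p') ^ 2)) hσ0
    (by
      subst hP
      intro i
      fin_cases i <;> simp [hb0, hb1] <;> field_simp <;> ring)
    (by
      subst hP
      rw [hσ]
      intro i
      fin_cases i <;> simp [hb0, hb1] <;> field_simp <;> ring)
  intro F
  have hMτ : ∀ᵐ ω ∂Pr, Tendsto (fun n : ℕ => (N (n * t) ω : ℝ) / n) atTop (𝓝 (c * t)) := by
    filter_upwards [hNLLN] with ω hω
    refine ((hω.comp (tendsto_natCast_atTop_atTop.atTop_mul_const ht)).mul_const t).congr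
      fun n => ?_
    rw [Function.comp_apply]
    field_simp
  have key := tendsto_integral_stoppedSum hXmeas (measurable_of_finite b) hσ0 hC
    (M := fun n ω => N (n * t) ω) (fun n => hNmeas _)
    (fun n => hindep.comp (measurable_pi_apply (n * t)) measurable_id)
    (mul_pos hc ht).le hMτ S0 F
  rw [← mul_assoc] at key
  refine key.congr fun n => integral_congr_ae (ae_of_all _ fun ω => ?_)
  have hsum : ∑ k ∈ Finset.Icc 1 (N (n * t) ω), b (X k ω)
      = ∑ k ∈ Finset.Icc 1 (N (n * t) ω), a (X k ω) - N (n * t) ω * astar := by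
    simp [hb, Finset.sum_sub_distrib]
  simp only [hS, hsum, add_sub_assoc]
end
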